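/- arXiv:1511.07044 — 2 statements merged into one kernel-verified Lean document; each statement's English description precedes it below -/
import Mathlib

section
/- Let d ≥ 3 and let f be a nonzero binary form of degree d which is not of the form λ·ℓ^d for any λ ∈ ℝ and real linear form ℓ. Then the real Waring rank of f equals d if and only if f is hyperbolic. -/
open scoped BigOperators
open MvPolynomial

/-- The real Waring rank of a binary form `f` of degree `d`: the least `r : ℕ∞` such that
`f = ∑ λᵢ ℓᵢ^d` for real numbers `λᵢ` and real linear forms `ℓᵢ` (`∞` if none exists). -/
noncomputable def waringRank (d : ℕ) (f : MvPolynomial (Fin 2) ℝ) : ℕ∞ :=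
  sInf ((fun n : ℕ => (n : ℕ∞)) ''
    {r : ℕ | ∃ lam : Fin r → ℝ, ∃ l : Fin r → ℝ × ℝ,
      f = ∑ i, C (lam i) * (C (l i).1 * X 0 + C (l i).2 * X 1) ^ d})

/-- A binary form of degree `d` is hyperbolic if it is a product of `d` real linear forms. -/
def Hyperbolic (d : ℕ) (f : MvPolynomial (Fin 2) ℝ) : Prop :=
  ∃ l : Fin d → ℝ × ℝ, f = ∏ i, (C (l i).1 * X 0 + C (l i).2 * X 1)

namespace Polynomial

/-- The apolarity functional of `q`, regarded as a binary form of degree `d`: it sends `X ^ k` to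
the coefficient of `X ^ (d - k)` in `q` divided by `d.choose k`. -/
noncomputable def apolar (d : ℕ) (q : ℝ[X]) : ℝ[X] →ₗ[ℝ] ℝ :=
  ∑ k ∈ Finset.range (d + 1), (q.coeff (d - k) / d.choose k) • lcoeff ℝ k

lemma apolar_apply (d : ℕ) (q p : ℝ[X]) :
    apolar d q p = ∑ k ∈ Finset.range (d + 1), q.coeff (d - k) / d.choose k * p.coeff k := by
  simp [apolar, LinearMap.sum_apply]

lemma apolar_X_pow {d k : ℕ} (q : ℝ[X]) (hk : k ≤ d) :
    apolar d q (X ^ k) = q.coeff (d - k) / d.choose k := by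
  rw [apolar_apply, Finset.sum_eq_single k]
  · simp
  · intro j _ hj
    simp [coeff_X_pow, hj]
  · intro h
    exact absurd (Finset.mem_range.2 (Nat.lt_succ_of_le hk)) h

lemma apolar_add (d : ℕ) (q₁ q₂ p : ℝ[X]) :
    apolar d (q₁ + q₂) p = apolar d q₁ p + apolar d q₂ p := by
  simp only [apolar_apply, coeff_add, ← Finset.sum_add_distrib]
  exact Finset.sum_congr rfl fun k _ => by ring

lemma apolar_C_mul (d : ℕ) (c : ℝ) (q p : ℝ[X]) :
    apolar d (C c * q) p = c * apolar d q p := by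
  simp only [apolar_apply, coeff_C_mul, Finset.mul_sum]
  exact Finset.sum_congr rfl fun k _ => by ring

lemma apolar_sum {ι : Type*} (d : ℕ) (s : Finset ι) (q : ι → ℝ[X]) (p : ℝ[X]) :
    apolar d (∑ i ∈ s, q i) p = ∑ i ∈ s, apolar d (q i) p := by
  simp only [apolar_apply, finsetSum_coeff, Finset.sum_div, Finset.sum_mul]
  exact Finset.sum_comm

lemma apolar_X_add_C_pow {d : ℕ} (b : ℝ) {p : ℝ[X]} (hp : p.natDegree ≤ d) :
    apolar d ((X + C b) ^ d) p = p.eval b := by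
  rw [apolar_apply, eval_eq_sum_range' (Nat.lt_succ_of_le hp)]
  refine Finset.sum_congr rfl fun k hk => ?_
  have hk' : k ≤ d := Nat.lt_succ_iff.1 (Finset.mem_range.1 hk)
  have hne : (d.choose k : ℝ) ≠ 0 := by exact_mod_cast (Nat.choose_pos hk').ne'
  rw [coeff_X_add_C_pow, Nat.sub_sub_self hk', Nat.choose_symm hk']
  field_simp

lemma apolar_C (d : ℕ) (c : ℝ) (p : ℝ[X]) : apolar d (C c) p = c * p.coeff d := by
  rw [apolar_apply, Finset.sum_eq_single d]
  · simp
  · intro j hj hjd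
    have : d - j ≠ 0 := by have := Finset.mem_range.1 hj; omega
    simp [coeff_C, this]
  · simp

lemma apolar_X {d : ℕ} (hd : 1 ≤ d) (p : ℝ[X]) : apolar d X p = p.coeff (d - 1) / d := by
  rw [apolar_apply, Finset.sum_eq_single (d - 1)]
  · rw [Nat.sub_sub_self hd, Nat.choose_symm hd]
    simp [div_eq_inv_mul]
  · intro j hj hjd
    have : ¬ 1 = d - j := by have := Finset.mem_range.1 hj; omega
    simp [coeff_X, this]
  · intro h
    exact absurd (Finset.mem_range.2 (by omega)) h

/-- If the apolarity functional of `q` annihilates the multiples of degree at most `d` of the nodal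
polynomial of `S`, then it is a combination of evaluations at the points of `S`. -/
lemma apolar_eq_sum_eval {d : ℕ} (q : ℝ[X]) (S : Finset ℝ)
    (h : ∀ j, j + S.card ≤ d → apolar d q (X ^ j * Lagrange.nodal S id) = 0)
    {p : ℝ[X]} (hp : p.natDegree ≤ d) :
    apolar d q p = ∑ s ∈ S, apolar d q (Lagrange.basis S id s) * p.eval s := by
  set g := Lagrange.nodal S (id : ℝ → ℝ) with hg
  have hgm : g.Monic := Lagrange.nodal_monic
  have hgd : g.natDegree = S.card := Lagrange.natDegree_nodal
  have hquot : apolar d q (g * (p /ₘ g)) = 0 := by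
    rw [as_sum_range (p /ₘ g), Finset.mul_sum, map_sum]
    refine Finset.sum_eq_zero fun j hj => ?_
    rw [← C_mul_X_pow_eq_monomial, mul_left_comm, ← smul_eq_C_mul, map_smul, mul_comm g]
    by_cases hjd : j + S.card ≤ d
    · rw [h j hjd, smul_zero]
    · have h1 := natDegree_divByMonic p hgm
      have h2 := Finset.mem_range.1 hj
      have h3 : p.natDegree < g.natDegree := by omega
      rw [(divByMonic_eq_zero_iff hgm).2 (degree_lt_degree h3)]
      simp
  have hmod : p %ₘ g = Lagrange.interpolate S id fun s => p.eval s := by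
    refine Lagrange.eq_interpolate_of_eval_eq _ Function.injective_id.injOn ?_ ?_
    · rw [← Lagrange.degree_nodal (s := S) (v := (id : ℝ → ℝ))]
      exact degree_modByMonic_lt _ hgm
    · intro s hs
      conv_rhs => rw [← modByMonic_add_div p g]
      simp [hg,
        show eval s (Lagrange.nodal S id) = 0 from
          Lagrange.eval_nodal_at_node (v := (id : ℝ → ℝ)) hs]
  conv_lhs => rw [← modByMonic_add_div p g, map_add, hquot, add_zero, hmod,
    Lagrange.interpolate_apply, map_sum]
  refine Finset.sum_congr rfl fun s _ => ?_
  rw [← smul_eq_C_mul, map_smul, smul_eq_mul, mul_comm]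

lemma eq_sum_pow_of_apolar {d : ℕ} {q : ℝ[X]} (hq : q.natDegree ≤ d) (S : Finset ℝ)
    (h : ∀ j, j + S.card ≤ d → apolar d q (X ^ j * Lagrange.nodal S id) = 0) :
    q = ∑ s ∈ S, C (apolar d q (Lagrange.basis S id s)) * (X + C s) ^ d := by
  ext n
  by_cases hn : n ≤ d
  · have hne : (d.choose n : ℝ) ≠ 0 := by exact_mod_cast (Nat.choose_pos hn).ne'
    have := apolar_eq_sum_eval q S h (p := X ^ (d - n)) (by simp)
    rw [apolar_X_pow q (Nat.sub_le d n), Nat.sub_sub_self hn, Nat.choose_symm hn,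
      div_eq_iff hne] at this
    simp only [this, finsetSum_coeff, coeff_C_mul, coeff_X_add_C_pow, eval_pow, eval_X,
      Finset.sum_mul, mul_assoc]
  · rw [coeff_eq_zero_of_natDegree_lt (by omega), finsetSum_coeff]
    refine (Finset.sum_eq_zero fun s _ => ?_).symm
    rw [coeff_C_mul, coeff_X_add_C_pow, Nat.choose_eq_zero_of_lt (by omega)]
    simp

/-- `q`, regarded as a binary form of degree `d`, is a combination of at most `r` powers of linear
forms, sorted into powers of `X + b` and constants (powers of the linear form at infinity). -/
def IsPowerSum (d r : ℕ) (q : ℝ[X]) : Prop :=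
  ∃ (B : Finset ℝ) (μ : ℝ → ℝ) (κ : ℝ),
    q = ∑ b ∈ B, C (μ b) * (X + C b) ^ d + C κ ∧ B.card ≤ r ∧ (κ = 0 ∨ B.card < r)

lemma exists_three_of_sum_of_prod (τ ρ : ℝ) (hρ : ρ ≠ 0) (F : Finset ℝ) (hF : 0 ∉ F) :
    ∃ u v w : ℝ, u ≠ v ∧ u ≠ w ∧ v ≠ w ∧ u ∉ F ∧ v ∉ F ∧ w ∉ F ∧
      u + v + w = τ ∧ u * v * w = ρ := by
  have hβ : ∀ β ∈ F, ∀ᶠ u : ℝ in Filter.atTop, u * β * (τ - u - β) ≠ ρ := by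
    intro β hβF
    have hβ0 : β ≠ 0 := fun h => hF (h ▸ hβF)
    have hP : (X * C β * (C τ - X - C β) - C ρ : ℝ[X]) ≠ 0 := by
      intro h
      have := congrArg (eval 0) h
      simp [hρ] at this
    filter_upwards [eventually_atTop_not_isRoot _ hP] with u hu h
    exact hu (by simp only [IsRoot, eval_sub, eval_mul, eval_X, eval_C, h, sub_self])
  have hdiag : ∀ᶠ u : ℝ in Filter.atTop, u * u * (τ - 2 * u) ≠ ρ := by
    have hP : (X * X * (C τ - C 2 * X) - C ρ : ℝ[X]) ≠ 0 := by
      intro h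
      have := congrArg (eval 0) h
      simp [hρ] at this
    filter_upwards [eventually_atTop_not_isRoot _ hP] with u hu h
    exact hu (by simp only [IsRoot, eval_sub, eval_mul, eval_X, eval_C, h, sub_self])
  have hFev : ∀ᶠ u : ℝ in Filter.atTop, u ∉ F := by
    have : ∀ᶠ u : ℝ in Filter.atTop, ∀ β ∈ F, u ≠ β :=
      (Filter.eventually_all_finset F).2 fun β _ => Filter.eventually_ne_atTop β
    filter_upwards [this] with u hu h using hu u h rfl
  obtain ⟨u, h1, h2, h3, h4⟩ := (((Filter.eventually_all_finset F).2 hβ).and (hdiag.and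
    (hFev.and (Filter.eventually_ge_atTop (|τ| + 4 * |ρ| + 2))))).exists
  have hτ := abs_nonneg τ
  have hρ' := abs_nonneg ρ
  have hu2 : 2 ≤ u := by linarith
  have hu0 : u ≠ 0 := by linarith
  set D := (τ - u) ^ 2 - 4 * (ρ / u) with hD
  have hDpos : 0 < D := by
    have h5 : ρ / u ≤ |ρ| / 2 := by
      refine (div_le_div_of_nonneg_right (le_abs_self ρ) (by linarith)).trans ?_
      exact div_le_div_of_nonneg_left hρ' (by norm_num) hu2
    have h6 : 4 * |ρ| + 2 ≤ u - τ := by linarith [le_abs_self τ]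
    nlinarith
  have hs := Real.sq_sqrt hDpos.le
  have hspos := Real.sqrt_pos.2 hDpos
  set σ := Real.sqrt D
  have hprod : ∀ v w : ℝ, v + w = τ - u → v * w = ρ / u → u * v * (τ - u - v) = ρ := by
    intro v w hv hw
    rw [← hv, add_sub_cancel_left, mul_assoc, hw]
    field_simp
  have hvw : (τ - u + σ) / 2 * ((τ - u - σ) / 2) = ρ / u := by
    linear_combination (-1 / 4 : ℝ) * hs - (1 / 4 : ℝ) * hD
  have hv := hprod ((τ - u + σ) / 2) ((τ - u - σ) / 2) (by ring) hvw
  have hw := hprod ((τ - u - σ) / 2) ((τ - u + σ) / 2) (by ring) (by rw [mul_comm]; exact hvw)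
  refine ⟨u, (τ - u + σ) / 2, (τ - u - σ) / 2, ?_, ?_, ?_, h3, ?_, ?_, by ring, ?_⟩
  · intro h
    rw [← h] at hv
    exact h2 (by linear_combination hv)
  · intro h
    rw [← h] at hw
    exact h2 (by linear_combination hw)
  · intro h
    linarith
  · exact fun h => h1 _ h hv
  · exact fun h => h1 _ h hw
  · rw [mul_assoc, hvw]
    field_simp

lemma exists_power_sum_of_add_linear {d : ℕ} (hd : 4 ≤ d) (B : Finset ℝ) (hB : B.card = d - 3)
    (μ : ℝ → ℝ) {b₀ : ℝ} (hb₀ : b₀ ∈ B) (hμ : μ b₀ ≠ 0) {κ : ℝ} (hκ : κ ≠ 0) (c : ℝ) :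
    ∃ (S : Finset ℝ) (ν : ℝ → ℝ), S.card = d - 1 ∧
      ∑ b ∈ B, C (μ b) * (X + C b) ^ d + (C κ * X + C c) =
        ∑ s ∈ S, C (ν s) * (X + C s) ^ d := by
  have hd0 : (d : ℝ) ≠ 0 := by
    have : d ≠ 0 := by omega
    exact_mod_cast this
  set B₀ := B.erase b₀ with hB₀
  have hB₀card : B₀.card = d - 4 := by rw [hB₀, Finset.card_erase_of_mem hb₀, hB]; omega
  set α := (Lagrange.nodal B₀ id).eval b₀ with hα
  have hα0 : α ≠ 0 := Lagrange.eval_nodal_not_at_node fun i hi =>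
    (Finset.ne_of_mem_erase hi).symm
  set κ' := κ / d with hκ'
  have hκ0 : κ' ≠ 0 := div_ne_zero hκ hd0
  obtain ⟨u, v, w, huv, huw, hvw, hu, hv, hw, hsum, hprod⟩ :=
    exists_three_of_sum_of_prod (c / κ' - 4 * b₀ - ∑ b ∈ B₀, b) (κ' / (μ b₀ * α))
      (div_ne_zero hκ0 (mul_ne_zero hμ hα0)) (B₀.image fun b => b - b₀) (by
        intro h
        obtain ⟨b, hb, hb'⟩ := Finset.mem_image.1 h
        exact Finset.ne_of_mem_erase hb (sub_eq_zero.1 hb'))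
  have key : ∀ x : ℝ, x ∉ B₀.image (fun b => b - b₀) → b₀ + x ∉ B₀ := fun x hx h =>
    hx (Finset.mem_image.2 ⟨b₀ + x, h, by ring⟩)
  have hw' : b₀ + w ∉ B₀ := key w hw
  have hv' : b₀ + v ∉ insert (b₀ + w) B₀ := by
    simp [key v hv, hvw]
  have hu' : b₀ + u ∉ insert (b₀ + v) (insert (b₀ + w) B₀) := by
    simp [key u hu, huv, huw]
  set S := insert (b₀ + u) (insert (b₀ + v) (insert (b₀ + w) B₀)) with hS
  have hScard : S.card = d - 1 := by
    rw [hS, Finset.card_insert_of_notMem hu', Finset.card_insert_of_notMem hv',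
      Finset.card_insert_of_notMem hw', hB₀card]
    omega
  set g := Lagrange.nodal S (id : ℝ → ℝ) with hg
  have hgd : g.natDegree = d - 1 := by rw [← hScard]; exact Lagrange.natDegree_nodal
  have hgm : g.Monic := Lagrange.nodal_monic
  have hgb₀ : g.eval b₀ = -(κ' / μ b₀) := by
    rw [hg, hS, Lagrange.nodal_insert_eq_nodal hu', Lagrange.nodal_insert_eq_nodal hv',
      Lagrange.nodal_insert_eq_nodal hw']
    simp only [id, eval_mul, eval_sub, eval_X, eval_C, ← hα]
    have : u * v * w * α = κ' / μ b₀ := by rw [hprod]; field_simp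
    linear_combination -this
  have hgB₀ : ∀ b ∈ B₀, g.eval b = 0 := fun b hb =>
    Lagrange.eval_nodal_at_node (v := (id : ℝ → ℝ)) (by simp [hS, hb])
  have hgtop : g.coeff (d - 1) = 1 := by rw [← hgd]; exact hgm.coeff_natDegree
  have hgnext : g.coeff (d - 2) = -(c / κ' - b₀) := by
    have h1 : g.nextCoeff = g.coeff (d - 2) := by
      rw [nextCoeff_of_natDegree_pos (by omega), hgd]; rfl
    rw [← h1, hg, Lagrange.nodal_eq, prod_X_sub_C_nextCoeff, hS, Finset.sum_insert hu',
      Finset.sum_insert hv', Finset.sum_insert hw']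
    simp only [id]
    linear_combination -hsum
  set q : ℝ[X] := ∑ b ∈ B, C (μ b) * (X + C b) ^ d + (C κ * X + C c) with hq
  have hL : ∀ p : ℝ[X], p.natDegree ≤ d → apolar d q p =
      μ b₀ * p.eval b₀ + ∑ b ∈ B₀, μ b * p.eval b + (κ' * p.coeff (d - 1) + c * p.coeff d) := by
    intro p hp
    rw [hq, apolar_add, apolar_add, apolar_sum, apolar_C_mul, apolar_X (by omega), apolar_C,
      ← Finset.add_sum_erase B _ hb₀, apolar_C_mul, apolar_X_add_C_pow b₀ hp]
    have : ∀ b ∈ B₀, apolar d (C (μ b) * (X + C b) ^ d) p = μ b * p.eval b := fun b _ => by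
      rw [apolar_C_mul, apolar_X_add_C_pow b hp]
    rw [Finset.sum_congr rfl this, hκ']
    ring
  have hqd : q.natDegree ≤ d := by
    refine natDegree_add_le_of_degree_le (natDegree_sum_le_of_forall_le _ _ fun b _ => ?_) ?_
    · refine (natDegree_C_mul_le _ _).trans ?_
      rw [natDegree_pow, natDegree_X_add_C, mul_one]
    · exact (natDegree_linear_le).trans (by omega)
  refine ⟨S, _, hScard, eq_sum_pow_of_apolar hqd S ?_⟩
  intro j hj
  have hj' : j = 0 ∨ j = 1 := by omega
  rcases hj' with rfl | rfl
  · rw [pow_zero, one_mul, hL g (by omega), Finset.sum_eq_zero fun b hb => by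
      rw [hgB₀ b hb, mul_zero],
      hgb₀, hgtop, coeff_eq_zero_of_natDegree_lt (by omega : g.natDegree < d)]
    field_simp
    ring
  · have hXd : (X * g).natDegree ≤ d := by
      refine natDegree_mul_le.trans ?_
      rw [natDegree_X]
      omega
    have e1 : (X * g).coeff (d - 1) = g.coeff (d - 2) := by
      rw [show d - 1 = (d - 2) + 1 by omega, coeff_X_mul]
    have e2 : (X * g).coeff d = g.coeff (d - 1) := by
      conv_lhs => rw [show d = (d - 1) + 1 by omega, coeff_X_mul]
    rw [pow_one, hL _ hXd, Finset.sum_eq_zero fun b hb => by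
      rw [eval_mul, hgB₀ b hb, mul_zero, mul_zero], eval_mul, hgb₀, e1, e2, hgtop, hgnext, eval_X]
    field_simp
    ring

lemma eq_sum_pow_add_linear_of_derivative {n : ℕ} {q : ℝ[X]} (B : Finset ℝ) (μ : ℝ → ℝ) (κ : ℝ)
    (h : derivative q = ∑ b ∈ B, C (μ b) * (X + C b) ^ n + C κ) :
    ∃ c, q = ∑ b ∈ B, C (μ b / (n + 1)) * (X + C b) ^ (n + 1) + (C κ * X + C c) := by
  have hn : (n + 1 : ℝ) ≠ 0 := by positivity
  set r : ℝ[X] := ∑ b ∈ B, C (μ b / (n + 1)) * (X + C b) ^ (n + 1) + C κ * X with hr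
  have hder : derivative r = derivative q := by
    rw [h, hr, derivative_add, derivative_sum, derivative_C_mul, derivative_X, mul_one]
    congr 1
    refine Finset.sum_congr rfl fun b _ => ?_
    rw [derivative_C_mul, derivative_X_add_C_pow, Nat.add_sub_cancel, ← mul_assoc, ← C_mul]
    congr 2
    push_cast
    field_simp
  have h0 : (q - r).natDegree = 0 :=
    derivative_eq_zero.1 (by rw [derivative_sub, hder, sub_self])
  refine ⟨(q - r).coeff 0, ?_⟩
  rw [← add_assoc, ← eq_C_of_natDegree_eq_zero h0]
  ring

lemma IsPowerSum.of_derivative {n : ℕ} (hn : 3 ≤ n) {q : ℝ[X]} (hq : ¬ q.Splits)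
    (h : IsPowerSum n (n - 1) (derivative q)) : IsPowerSum (n + 1) n q := by
  obtain ⟨B, μ, κ, hder, hB, hκ⟩ := h
  obtain ⟨c, hc⟩ := eq_sum_pow_add_linear_of_derivative B μ κ hder
  by_cases hκ0 : κ = 0
  · refine ⟨B, fun b => μ b / (n + 1), c, ?_, by omega, Or.inr (by omega)⟩
    rw [hc, hκ0]
    simp
  have hBlt : B.card < n - 1 := hκ.resolve_left hκ0
  by_cases hμ : ∃ b₀ ∈ B, μ b₀ ≠ 0
  · obtain ⟨b₀, hb₀, hμb₀⟩ := hμ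
    obtain ⟨B', hBB', hB'⟩ := Infinite.exists_superset_card_eq B (n - 2) (by omega)
    obtain ⟨S, ν, hS, hSq⟩ := exists_power_sum_of_add_linear (d := n + 1) (by omega) B'
      (by omega) (fun b => if b ∈ B then μ b / (n + 1) else 0) (hBB' hb₀)
      (by simp only [hb₀, if_true]; positivity) hκ0 c
    refine ⟨S, ν, 0, ?_, by omega, Or.inl rfl⟩
    rw [C_0, add_zero, ← hSq, hc]
    congr 1
    rw [← Finset.sum_subset hBB']
    · exact Finset.sum_congr rfl fun b hb => by simp only [hb, if_true]
    · intro b _ hb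
      simp [hb]
  · push Not at hμ
    refine absurd ?_ hq
    rw [hc, Finset.sum_eq_zero fun b hb => by rw [hμ b hb]; simp, zero_add]
    exact Splits.of_natDegree_le_one natDegree_linear_le

/-- A nonconstant form `κ x y ^ (d - 1) + c y ^ d` needs at least `d` powers of linear forms. -/
lemma IsPowerSum.eq_zero_of_linear {d r : ℕ} (hd : 1 ≤ d) (hr : r < d) {κ c : ℝ}
    (h : IsPowerSum d r (C κ * X + C c)) : κ = 0 := by
  obtain ⟨B, μ, κ₂, hq, hB, hκ₂⟩ := h
  have hd0 : (d : ℝ) ≠ 0 := by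
    have : d ≠ 0 := by omega
    exact_mod_cast this
  have hL : ∀ p : ℝ[X], p.natDegree < d →
      κ * (p.coeff (d - 1) / d) = ∑ b ∈ B, μ b * p.eval b := by
    intro p hp
    have h1 := congrArg (fun q => apolar d q p) hq
    simp only [apolar_add, apolar_sum, apolar_C_mul, apolar_X hd, apolar_C,
      coeff_eq_zero_of_natDegree_lt hp, mul_zero, add_zero] at h1
    rw [h1]
    exact Finset.sum_congr rfl fun b _ => by rw [apolar_X_add_C_pow b hp.le]
  obtain ⟨S, hBS, hS⟩ := Infinite.exists_superset_card_eq B (d - 1) (by omega)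
  have hgd : (Lagrange.nodal S (id : ℝ → ℝ)).natDegree = d - 1 := by
    rw [← hS]; exact Lagrange.natDegree_nodal
  have h2 := hL (Lagrange.nodal S id) (by omega)
  rw [Finset.sum_eq_zero fun b hb => by
    rw [show eval b (Lagrange.nodal S id) = 0 from
      Lagrange.eval_nodal_at_node (v := (id : ℝ → ℝ)) (hBS hb), mul_zero]] at h2
  have h3 : (Lagrange.nodal S (id : ℝ → ℝ)).coeff (d - 1) = 1 := by
    rw [← hgd]; exact Lagrange.nodal_monic.coeff_natDegree
  rw [h3] at h2
  rcases mul_eq_zero.1 h2 with h | h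
  · exact h
  · exact absurd h (one_div_ne_zero hd0)

lemma Splits.derivative_real {p : ℝ[X]} (hp : p.Splits) : (derivative p).Splits := by
  rw [splits_iff_card_roots] at hp ⊢
  have h1 := card_roots_le_derivative p
  have h2 := card_roots' (derivative p)
  have h3 := natDegree_derivative_le p
  by_cases h0 : p.natDegree = 0
  · rw [derivative_of_natDegree_zero h0]; simp
  · have h4 := natDegree_derivative_lt h0
    omega

/-- A form of degree `n + 1 ≥ 3` that splits and whose `x`-derivative is a multiple of the `n`-th
power of a linear form not proportional to `y` is itself a multiple of a power. -/
lemma Splits.eq_pow_of_derivative_eq_pow {n : ℕ} (hn : 2 ≤ n) {p : ℝ[X]} (hp : p.Splits)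
    {lam a b : ℝ} (ha : a ≠ 0) (hder : derivative p = C lam * (C a * X + C b) ^ n) :
    ∃ lam' a' b', p = C lam' * (C a' * X + C b') ^ (n + 1) := by
  by_cases hlam : lam = 0
  · have h0 : p.natDegree = 0 := derivative_eq_zero.1 (by simp [hder, hlam])
    exact ⟨p.coeff 0, 0, 1, by rw [eq_C_of_natDegree_eq_zero h0]; simp⟩
  have hn1 : (n + 1 : ℝ) ≠ 0 := by positivity
  set μ := lam / (a * (n + 1)) with hμ
  set r : ℝ[X] := C μ * (C a * X + C b) ^ (n + 1) with hr
  have hrder : derivative r = derivative p := by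
    rw [hder, hr, derivative_C_mul, derivative_pow]
    simp only [derivative_add, derivative_mul, derivative_C, derivative_X, Nat.add_sub_cancel]
    rw [show (C lam : ℝ[X]) = C μ * C (((n + 1 : ℕ) : ℝ)) * C a by
      rw [← C_mul, ← C_mul, hμ]; congr 1; push_cast; field_simp]
    ring
  have h0 : (p - r).natDegree = 0 :=
    derivative_eq_zero.1 (by rw [derivative_sub, hrder, sub_self])
  set e := (p - r).coeff 0 with he
  have hpe : p = r + C e := by
    rw [he, ← eq_C_of_natDegree_eq_zero h0]; ring
  by_cases he0 : e = 0
  · exact ⟨μ, a, b, by rw [hpe, he0, C_0, add_zero]⟩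
  exfalso
  have hlin : (C a * X + C b : ℝ[X]).natDegree = 1 := natDegree_linear ha
  have hdn : (derivative p).natDegree = n := by
    rw [hder, natDegree_C_mul hlam, natDegree_pow, hlin, mul_one]
  have hpn : p.natDegree = n + 1 := by
    have hμ0 : μ ≠ 0 := div_ne_zero hlam (mul_ne_zero ha hn1)
    rw [hpe, natDegree_add_C, hr, natDegree_C_mul hμ0, natDegree_pow, hlin, mul_one]
  have hp0 : p ≠ 0 := fun h => by rw [h, natDegree_zero] at hpn; omega
  have hd0 : derivative p ≠ 0 := fun h => by rw [h, natDegree_zero] at hdn; omega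
  have hcrit : ∀ x, (derivative p).IsRoot x → x = -b / a ∧ ¬ p.IsRoot x := by
    intro x hx
    rw [IsRoot, hder] at hx
    simp only [eval_mul, eval_C, eval_pow, eval_add, eval_X] at hx
    have hx' : a * x + b = 0 := by
      rcases mul_eq_zero.1 hx with h | h
      · exact absurd h hlam
      · exact pow_eq_zero_iff (by omega) |>.1 h
    refine ⟨by field_simp; linarith, ?_⟩
    rw [IsRoot, hpe, hr]
    simp [hx', he0]
  have hnodup : p.roots.Nodup := by
    rw [Multiset.nodup_iff_count_le_one]
    intro x
    rw [count_roots]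
    by_contra hlt
    push Not at hlt
    obtain ⟨hx1, hx2⟩ := (one_lt_rootMultiplicity_iff_isRoot hp0).1 hlt
    exact (hcrit x hx2).2 hx1
  have hcard : p.roots.toFinset.card = n + 1 := by
    rw [Multiset.toFinset_card_of_nodup hnodup, splits_iff_card_roots.1 hp, hpn]
  have h1 := card_roots_toFinset_le_card_roots_derivative_sdiff_roots_succ p
  have h2 : ((derivative p).roots.toFinset \ p.roots.toFinset).card ≤ 1 := by
    refine (Finset.card_le_card (t := {-b / a}) fun x hx => ?_).trans (by simp)
    rw [Finset.mem_sdiff, Multiset.mem_toFinset, mem_roots hd0] at hx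
    exact Finset.mem_singleton.2 (hcrit x hx.1).1
  omega

/-- `q`, regarded as a binary form of degree `d`, is a combination of `r` powers of real linear
forms. -/
def IsWaringSum (d r : ℕ) (q : ℝ[X]) : Prop :=
  ∃ lam a b : Fin r → ℝ, q = ∑ i, C (lam i) * (C (a i) * X + C (b i)) ^ d

lemma IsWaringSum.add {d r₁ r₂ : ℕ} {p q : ℝ[X]} (hp : IsWaringSum d r₁ p)
    (hq : IsWaringSum d r₂ q) : IsWaringSum d (r₁ + r₂) (p + q) := by
  obtain ⟨lam₁, a₁, b₁, rfl⟩ := hp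
  obtain ⟨lam₂, a₂, b₂, rfl⟩ := hq
  exact ⟨Fin.append lam₁ lam₂, Fin.append a₁ a₂, Fin.append b₁ b₂, by simp [Fin.sum_univ_add]⟩

lemma isWaringSum_zero (d r : ℕ) : IsWaringSum d r 0 :=
  ⟨0, 0, 0, by simp⟩

lemma isWaringSum_one (d : ℕ) (lam a b : ℝ) :
    IsWaringSum d 1 (C lam * (C a * X + C b) ^ d) :=
  ⟨fun _ => lam, fun _ => a, fun _ => b, by simp⟩

lemma IsWaringSum.mono {d r₁ r₂ : ℕ} (h : r₁ ≤ r₂) {p : ℝ[X]} (hp : IsWaringSum d r₁ p) :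
    IsWaringSum d r₂ p := by
  obtain ⟨k, rfl⟩ := Nat.exists_eq_add_of_le h
  simpa using hp.add (isWaringSum_zero d k)

lemma isWaringSum_finset (d : ℕ) (B : Finset ℝ) (μ : ℝ → ℝ) :
    IsWaringSum d B.card (∑ b ∈ B, C (μ b) * (X + C b) ^ d) := by
  induction B using Finset.induction_on with
  | empty => simpa using isWaringSum_zero d 0
  | insert b B hb ih =>
    rw [Finset.sum_insert hb, Finset.card_insert_of_notMem hb, add_comm (C _ * _)]
    simpa using ih.add (isWaringSum_one d (μ b) 1 b)

lemma IsWaringSum.derivative {d r : ℕ} {p : ℝ[X]} (h : IsWaringSum (d + 1) r p) :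
    IsWaringSum d r (derivative p) := by
  obtain ⟨lam, a, b, rfl⟩ := h
  refine ⟨fun i => lam i * (d + 1) * a i, a, b, ?_⟩
  rw [derivative_sum]
  refine Finset.sum_congr rfl fun i _ => ?_
  simp [derivative_pow]
  ring

lemma IsPowerSum.isWaringSum {d r : ℕ} {q : ℝ[X]} (h : IsPowerSum d r q) : IsWaringSum d r q := by
  obtain ⟨B, μ, κ, rfl, hB, hκ⟩ := h
  rcases hκ with rfl | hκ
  · simpa using (isWaringSum_finset d B μ).mono hB
  · have h1 : IsWaringSum d 1 (C κ) := by simpa using isWaringSum_one d κ 0 1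
    exact ((isWaringSum_finset d B μ).add h1).mono hκ

lemma IsPowerSum.add_pow {d r : ℕ} {q : ℝ[X]} (h : IsPowerSum d r q) (lam a b : ℝ) :
    IsPowerSum d (r + 1) (C lam * (C a * X + C b) ^ d + q) := by
  obtain ⟨B, μ, κ, rfl, hB, hκ⟩ := h
  by_cases ha : a = 0
  · refine ⟨B, μ, κ + lam * b ^ d, ?_, by omega, Or.inr (by omega)⟩
    simp only [ha, C_0, zero_mul, zero_add, C_add, C_mul, C_pow]
    ring
  · have hcard := Finset.card_insert_le (b / a) B
    refine ⟨insert (b / a) B, fun t => (if t ∈ B then μ t else 0) +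
      if t = b / a then lam * a ^ d else 0, κ, ?_, by omega, hκ.imp id fun h => by omega⟩
    have h1 : (C a * X + C b : ℝ[X]) = C a * (X + C (b / a)) := by
      rw [mul_add, ← C_mul, mul_div_cancel₀ _ ha]
    have h2 : ∑ t ∈ insert (b / a) B, C (if t ∈ B then μ t else 0) * (X + C t) ^ d =
        ∑ t ∈ B, C (μ t) * (X + C t) ^ d := by
      rw [← Finset.sum_subset (Finset.subset_insert (b / a) B) fun t _ ht => by simp [ht]]
      exact Finset.sum_congr rfl fun t ht => by rw [if_pos ht]
    simp only [C_add, add_mul, Finset.sum_add_distrib]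
    rw [h2, Finset.sum_eq_single_of_mem (b / a) (Finset.mem_insert_self _ _)
      fun t _ ht => by simp [ht], if_pos rfl, h1, mul_pow, C_mul, C_pow]
    ring

lemma IsWaringSum.isPowerSum {d r : ℕ} {q : ℝ[X]} (h : IsWaringSum d r q) : IsPowerSum d r q := by
  obtain ⟨lam, a, b, rfl⟩ := h
  induction r with
  | zero => exact ⟨∅, 0, 0, by simp, by simp, Or.inl rfl⟩
  | succ r ih =>
    rw [Fin.sum_univ_succ]
    exact (ih _ _ _).add_pow _ _ _

/-- A cubic with a pair of conjugate roots is a sum of two cubes of real linear forms. -/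
lemma isWaringSum_two_of_cubic {p : ℝ[X]} (hp : p.natDegree ≤ 3) {z : ℂ} (hz : z.im ≠ 0)
    (h : aeval z p = 0) : IsWaringSum 3 2 p := by
  obtain ⟨q, rfl⟩ := p.quadratic_dvd_of_aeval_eq_zero_im_ne_zero h hz
  by_cases hq0 : q = 0
  · simpa [hq0] using isWaringSum_zero 3 2
  set u := z.re
  set w := z.im
  have hnorm : ‖z‖ ^ 2 = u ^ 2 + w ^ 2 := by
    rw [Complex.sq_norm, Complex.normSq_apply]; ring
  have hQ : (X ^ 2 - C (2 * u) * X + C (‖z‖ ^ 2) : ℝ[X]).natDegree = 2 := by compute_degree!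
  have hq1 : q.natDegree ≤ 1 := by
    rw [natDegree_mul (fun h0 => by rw [h0, natDegree_zero] at hQ; omega) hq0, hQ] at hp
    omega
  obtain ⟨α, β, hαβ⟩ := exists_eq_X_add_C_of_natDegree_le_one hq1
  set γ := (β + α * u) / w with hγ
  have hβ : β = γ * w - α * u := by rw [hγ]; field_simp; ring
  have hN : α ^ 2 + γ ^ 2 ≠ 0 := by
    intro hN
    have hα : α = 0 := by nlinarith [sq_nonneg α, sq_nonneg γ]
    have hγ0 : γ = 0 := by nlinarith [sq_nonneg α, sq_nonneg γ]
    exact hq0 (by rw [hαβ, hβ, hα, hγ0]; simp)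
  obtain ⟨t, ht⟩ : ∃ t : ℝ, 3 * t ^ 2 = 1 :=
    ⟨√(1 / 3), by rw [Real.sq_sqrt (by norm_num)]; norm_num⟩
  -- the linear form orthogonal to `q` for the quadratic form given by the conjugate roots
  set a' := -γ with ha'
  set b' := γ * u + α * w with hb'
  convert IsWaringSum.add
    (isWaringSum_one 3 (1 / (2 * (α ^ 2 + γ ^ 2))) (α + t * a') (β + t * b'))
    (isWaringSum_one 3 (1 / (2 * (α ^ 2 + γ ^ 2))) (α - t * a') (β - t * b')) using 1
  refine Polynomial.funext fun x => ?_
  rw [hαβ, hnorm]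
  simp only [eval_add, eval_mul, eval_pow, eval_sub, eval_C, eval_X]
  rw [ha', hb', hβ]
  field_simp
  have : t ^ 2 = 1 / 3 := by linarith
  ring_nf
  rw [this]
  ring

end Polynomial

/-- Schwarz lemma for the upper half-plane: the derivative at a fixed point has norm at most one. -/
lemma Complex.norm_deriv_le_one_of_mapsTo_upperHalfPlane {ψ : ℂ → ℂ}
    (hd : ∀ z : ℂ, 0 < z.im → DifferentiableAt ℂ ψ z) (hmaps : ∀ z : ℂ, 0 < z.im → 0 < (ψ z).im)
    {z₀ : ℂ} (hz₀ : 0 < z₀.im) (hfix : ψ z₀ = z₀) : ‖deriv ψ z₀‖ ≤ 1 := by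
  set β := (starRingEnd ℂ) z₀ with hβ
  have hβre : β.re = z₀.re := Complex.conj_re z₀
  have hβim : β.im = -z₀.im := Complex.conj_im z₀
  set cay : ℂ → ℂ := fun w => (z₀ - β * w) / (1 - w) with hcay
  set inv : ℂ → ℂ := fun z => (z - z₀) / (z - β) with hinv
  have hden : ∀ z : ℂ, 0 < z.im → z - β ≠ 0 := by
    intro z hz h
    have := congrArg Complex.im h
    simp only [Complex.sub_im, hβim, Complex.zero_im] at this
    linarith
  have hone : ∀ w : ℂ, w ∈ Metric.ball (0 : ℂ) 1 → 1 - w ≠ 0 := by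
    intro w hw h
    rw [mem_ball_zero_iff, ← sub_eq_zero.1 h] at hw
    simp at hw
  have hcayim : ∀ w ∈ Metric.ball (0 : ℂ) 1, 0 < (cay w).im := by
    intro w hw
    have hnw : w.re * w.re + w.im * w.im < 1 := by
      rw [mem_ball_zero_iff] at hw
      rw [← Complex.normSq_apply, Complex.normSq_eq_norm_sq]
      nlinarith [norm_nonneg w]
    have hpos : 0 < Complex.normSq (1 - w) := Complex.normSq_pos.2 (hone w hw)
    have : (cay w).im = z₀.im * (1 - (w.re * w.re + w.im * w.im)) / Complex.normSq (1 - w) := by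
      simp only [hcay, Complex.div_im, Complex.sub_im, Complex.sub_re, Complex.mul_im,
        Complex.mul_re, hβre, hβim, Complex.one_re, Complex.one_im]
      field_simp
      ring
    rw [this]
    exact div_pos (mul_pos hz₀ (by linarith)) hpos
  have hinvball : ∀ z : ℂ, 0 < z.im → inv z ∈ Metric.ball (0 : ℂ) 1 := by
    intro z hz
    have hpos : 0 < ‖z - β‖ := norm_pos_iff.2 (hden z hz)
    rw [mem_ball_zero_iff, hinv, norm_div, div_lt_one hpos]
    refine lt_of_pow_lt_pow_left₀ 2 hpos.le ?_
    rw [Complex.sq_norm, Complex.sq_norm, Complex.normSq_apply, Complex.normSq_apply]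
    simp only [Complex.sub_re, Complex.sub_im, hβre, hβim]
    nlinarith [mul_pos hz hz₀]
  have hcay0 : cay 0 = z₀ := by simp [hcay]
  have hinv0 : inv z₀ = 0 := by simp [hinv]
  have hcayd : ∀ w ∈ Metric.ball (0 : ℂ) 1, DifferentiableAt ℂ cay w := fun w hw =>
    ((differentiableAt_const _).sub ((differentiableAt_const _).mul differentiableAt_id)).div
      ((differentiableAt_const _).sub differentiableAt_id) (hone w hw)
  have hinvd : ∀ z : ℂ, 0 < z.im → DifferentiableAt ℂ inv z := fun z hz =>
    (differentiableAt_id.sub (differentiableAt_const _)).div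
      (differentiableAt_id.sub (differentiableAt_const _)) (hden z hz)
  have hβz : z₀ - β ≠ 0 := hden z₀ hz₀
  have hcay' : HasDerivAt cay (z₀ - β) 0 := by
    have h1 : HasDerivAt (fun w : ℂ => z₀ - β * w) (-β) 0 := by
      simpa using ((hasDerivAt_id (0 : ℂ)).const_mul β).const_sub z₀
    have h2 : HasDerivAt (fun w : ℂ => 1 - w) (-1) 0 := by
      simpa using (hasDerivAt_id (0 : ℂ)).const_sub 1
    have h3 := h1.div h2 (by simp)
    refine h3.congr_deriv ?_
    simp
    ring
  have hinv' : HasDerivAt inv (1 / (z₀ - β)) z₀ := by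
    have h3 := ((hasDerivAt_id z₀).sub_const z₀).div ((hasDerivAt_id z₀).sub_const β) hβz
    refine h3.congr_deriv ?_
    simp only [id]
    field_simp
    ring
  have hψ' : HasDerivAt ψ (deriv ψ z₀) z₀ := (hd z₀ hz₀).hasDerivAt
  have hcomp : HasDerivAt (inv ∘ ψ ∘ cay) (deriv ψ z₀) 0 := by
    have h1 : HasDerivAt (ψ ∘ cay) (deriv ψ z₀ * (z₀ - β)) 0 :=
      HasDerivAt.comp (0 : ℂ) (by rw [hcay0]; exact hψ') hcay'
    have h2 : HasDerivAt (inv ∘ (ψ ∘ cay)) (1 / (z₀ - β) * (deriv ψ z₀ * (z₀ - β))) 0 :=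
      HasDerivAt.comp (0 : ℂ) (by rw [Function.comp_apply, hcay0, hfix]; exact hinv') h1
    refine h2.congr_deriv ?_
    field_simp
  rw [← hcomp.deriv]
  refine Complex.norm_deriv_le_one_of_mapsTo_ball (R := 1) ?_ ?_ one_pos
  · intro w hw
    exact ((hinvd _ (hmaps _ (hcayim w hw))).comp w
      ((hd _ (hcayim w hw)).comp w (hcayd w hw))).differentiableWithinAt
  · intro w hw
    simp only [Function.comp_apply, hcay0, hfix, hinv0]
    exact Metric.ball_subset_closedBall (hinvball _ (hmaps _ (hcayim w hw)))

namespace Polynomial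

/-- If a real form `p` of degree `d ≥ 3` has a nonreal zero, so does one of its first directional
derivatives `a * p' + c * (d * p - X * p')`. -/
lemma exists_polar_nonreal_root {d : ℕ} (hd : 3 ≤ d) {p : ℝ[X]} {z₀ : ℂ} (hz₀ : z₀.im ≠ 0)
    (h0 : aeval z₀ p = 0) :
    ∃ a c : ℝ, (a ≠ 0 ∨ c ≠ 0) ∧ ∃ z : ℂ, z.im ≠ 0 ∧
      (a : ℂ) * aeval z (derivative p) + c * (d * aeval z p - z * aeval z (derivative p)) = 0 := by
  wlog hpos : 0 < z₀.im generalizing z₀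
  · refine this (z₀ := (starRingEnd ℂ) z₀) ?_ ?_ ?_
    · simpa using hz₀
    · rw [aeval_conj, h0, map_zero]
    · rw [Complex.conj_im]
      have := lt_of_le_of_ne (not_lt.1 hpos) hz₀
      linarith
  by_contra! hne
  have hder : ∀ z : ℂ, 0 < z.im → aeval z (derivative p) ≠ 0 := fun z hz => by
    simpa using hne 1 0 (by simp) z hz.ne'
  set ψ : ℂ → ℂ := fun z => z - d * aeval z p / aeval z (derivative p) with hψ
  have hP : ∀ (q : ℝ[X]) (z : ℂ), HasDerivAt (fun z : ℂ => aeval z q) (aeval z (derivative q)) z :=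
    fun q z => q.hasDerivAt_aeval z
  have hψd : ∀ z : ℂ, 0 < z.im → HasDerivAt ψ (1 - (d * aeval z (derivative p) *
      aeval z (derivative p) - d * aeval z p * aeval z (derivative (derivative p))) /
        aeval z (derivative p) ^ 2) z := fun z hz =>
    (hasDerivAt_id z).sub (((hP p z).const_mul (d : ℂ)).div (hP (derivative p) z) (hder z hz))
  have him : ∀ z : ℂ, 0 < z.im → (ψ z).im ≠ 0 := by
    intro z hz him
    have hre : ψ z = ((ψ z).re : ℂ) := by
      apply Complex.ext <;> simp [him]
    refine hne (ψ z).re 1 (by simp) z hz.ne' ?_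
    rw [← hre]
    have := hder z hz
    simp only [hψ]
    push_cast
    field_simp
    ring
  have hfix : ψ z₀ = z₀ := by simp [hψ, h0]
  have hmaps : ∀ z : ℂ, 0 < z.im → 0 < (ψ z).im := by
    intro z hz
    by_contra hle
    have hconn : IsPreconnected {z : ℂ | 0 < z.im} := (convex_halfSpace_im_gt 0).isPreconnected
    have hcont : ContinuousOn (fun z => (ψ z).im) {z : ℂ | 0 < z.im} := fun w hw =>
      (Complex.continuous_im.continuousAt.comp (hψd w hw).continuousAt).continuousWithinAt
    obtain ⟨w, hw, hw0⟩ := hconn.intermediate_value (a := z) (b := z₀) hz hpos hcont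
      (show (0 : ℝ) ∈ Set.Icc _ _ from ⟨not_lt.1 hle, by rw [hfix]; exact hpos.le⟩)
    exact him w hw hw0
  have hle := Complex.norm_deriv_le_one_of_mapsTo_upperHalfPlane
    (fun z hz => (hψd z hz).differentiableAt) hmaps hpos hfix
  have hd0 := hder z₀ hpos
  have hval : deriv ψ z₀ = ((1 - d : ℝ) : ℂ) := by
    rw [(hψd z₀ hpos).deriv, h0]
    push_cast
    field_simp
    ring
  rw [hval, Complex.norm_real, Real.norm_eq_abs] at hle
  have hd' : (3 : ℝ) ≤ d := by exact_mod_cast hd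
  linarith [neg_abs_le (1 - (d : ℝ))]

lemma apolar_X_sub_C_pow {d : ℕ} {q : ℝ[X]} (hq : q.natDegree ≤ d) (s : ℝ) :
    apolar d q ((X - C s) ^ d) = q.eval (-s) := by
  rw [eval_eq_sum_range' (Nat.lt_succ_of_le hq), ← Finset.sum_range_reflect, apolar_apply]
  refine Finset.sum_congr rfl fun k hk => ?_
  have hk' : k ≤ d := Nat.lt_succ_iff.1 (Finset.mem_range.1 hk)
  have hne : (d.choose k : ℝ) ≠ 0 := by exact_mod_cast (Nat.choose_pos hk').ne'
  rw [sub_eq_add_neg, ← C_neg, coeff_X_add_C_pow, show d + 1 - 1 - k = d - k by omega]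
  field_simp

lemma apolar_X_sub_C_pow_pred {n : ℕ} {q : ℝ[X]} (hq : q.natDegree ≤ n + 1) (s : ℝ) :
    apolar (n + 1) q ((X - C s) ^ n) = (derivative q).eval (-s) / (n + 1) := by
  have hq' : (derivative q).natDegree ≤ n := (natDegree_derivative_le q).trans (by omega)
  have hn : (n + 1 : ℝ) ≠ 0 := by positivity
  rw [eval_eq_sum_range' (Nat.lt_succ_of_le hq'), ← Finset.sum_range_reflect, apolar_apply,
    Finset.sum_range_succ, Finset.sum_div]
  have htop : ((X - C s) ^ n : ℝ[X]).coeff (n + 1) = 0 := by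
    rw [sub_eq_add_neg, ← C_neg, coeff_X_add_C_pow, Nat.choose_eq_zero_of_lt (by omega)]
    simp
  rw [htop, mul_zero, add_zero]
  refine Finset.sum_congr rfl fun k hk => ?_
  have hk' : k ≤ n := Nat.lt_succ_iff.1 (Finset.mem_range.1 hk)
  have hne : ((n + 1).choose k : ℝ) ≠ 0 := by exact_mod_cast (Nat.choose_pos (by omega)).ne'
  have hch : (n.choose k : ℝ) * (n + 1) = (n + 1).choose k * ((n - k : ℕ) + 1) := by
    have := Nat.choose_mul_succ_eq n k
    rw [show n + 1 - k = (n - k) + 1 by omega] at this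
    exact_mod_cast this
  rw [sub_eq_add_neg, ← C_neg, coeff_X_add_C_pow, show n + 1 - 1 - k = n - k by omega,
    coeff_derivative, show n + 1 - k = (n - k) + 1 by omega]
  field_simp
  linear_combination (q.coeff (n - k + 1)) * (-s) ^ (n - k) * hch

lemma continuous_coeff_prod_X_sub_C {ι : Type*} (s : Finset ι) (b : ι → ℝ → ℝ)
    (hb : ∀ i, Continuous (b i)) (k : ℕ) :
    Continuous fun t => (∏ i ∈ s, (X - C (b i t))).coeff k := by
  classical
  induction s using Finset.induction_on generalizing k with
  | empty => simpa using continuous_const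
  | insert i s hi ih =>
    simp only [Finset.prod_insert hi, sub_mul, coeff_sub, coeff_C_mul]
    refine Continuous.sub ?_ ((hb i).mul (ih k))
    cases k with
    | zero => simpa using continuous_const
    | succ k => simpa only [coeff_X_mul] using ih k

/-- Every form of degree `d` that is not a multiple of `y ^ d` is a combination of `d` powers of
real linear forms. -/
lemma isPowerSum_self {d : ℕ} {q : ℝ[X]} (hq : q.natDegree ≤ d)
    (hq' : derivative q ≠ 0) : IsPowerSum d d q := by
  obtain ⟨n, rfl⟩ : ∃ n, d = n + 1 := by
    refine Nat.exists_eq_succ_of_ne_zero fun h => hq' (derivative_of_natDegree_zero ?_)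
    omega
  have hq0 : q ≠ 0 := fun h => hq' (by rw [h, derivative_zero])
  obtain ⟨x, hx⟩ : ∃ x, (q * derivative q).eval x ≠ 0 := by
    by_contra! h
    exact mul_ne_zero hq0 hq' (Polynomial.funext fun x => by rw [h x, eval_zero])
  rw [eval_mul] at hx
  set b : ℕ → ℝ → ℝ := fun i t => -x + t * i with hb
  have hbcont : ∀ i, Continuous (b i) := fun i => by fun_prop
  set g : ℝ → ℝ[X] := fun t => ∏ i ∈ Finset.range n, (X - C (b i t)) with hg
  have hcont1 : Continuous fun t => apolar (n + 1) q (g t) := by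
    simp only [apolar_apply]
    exact continuous_finsetSum _ fun k _ =>
      continuous_const.mul (continuous_coeff_prod_X_sub_C _ b hbcont k)
  have hcont2 : ∀ j, Continuous fun t => apolar (n + 1) q ((X - C (b j t)) * g t) := by
    intro j
    simp only [apolar_apply]
    refine continuous_finsetSum _ fun k _ => continuous_const.mul ?_
    simp only [sub_mul, coeff_sub, coeff_C_mul]
    refine Continuous.sub ?_ ((hbcont j).mul (continuous_coeff_prod_X_sub_C _ b hbcont k))
    cases k with
    | zero => simpa using continuous_const
    | succ k => simpa only [coeff_X_mul] using continuous_coeff_prod_X_sub_C _ b hbcont k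
  have hg0 : g 0 = (X - C (-x)) ^ n := by simp [hg, hb]
  have hev1 : ∀ᶠ t in nhds (0 : ℝ), apolar (n + 1) q (g t) ≠ 0 := by
    refine hcont1.continuousAt.eventually_ne ?_
    rw [hg0, apolar_X_sub_C_pow_pred hq, neg_neg]
    exact div_ne_zero (right_ne_zero_of_mul hx) (by positivity)
  have hev2 : ∀ᶠ t in nhds (0 : ℝ), ∀ j ∈ Finset.range n,
      apolar (n + 1) q ((X - C (b j t)) * g t) ≠ 0 := by
    refine (Filter.eventually_all_finset _).2 fun j _ => (hcont2 j).continuousAt.eventually_ne ?_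
    rw [hg0, show b j 0 = -x by simp [hb], ← pow_succ', apolar_X_sub_C_pow hq, neg_neg]
    exact left_ne_zero_of_mul hx
  obtain ⟨t, ⟨h1, h2⟩, ht⟩ := (((hev1.and hev2).filter_mono nhdsWithin_le_nhds).and
    (self_mem_nhdsWithin : Set.Ioi (0 : ℝ) ∈ nhdsWithin 0 (Set.Ioi 0))).exists
  have ht0 : t ≠ 0 := ne_of_gt ht
  have hinj : Function.Injective fun i => b i t := by
    intro i j hij
    simpa [hb, ht0] using hij
  set B := (Finset.range n).image fun i => b i t with hB
  have hBcard : B.card = n := by rw [hB, Finset.card_image_of_injective _ hinj, Finset.card_range]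
  have hgB : Lagrange.nodal B id = g t := by
    rw [Lagrange.nodal_eq, hB, Finset.prod_image hinj.injOn]
    rfl
  set y := apolar (n + 1) q (X * g t) / apolar (n + 1) q (g t) with hy
  have hlin : ∀ c : ℝ, apolar (n + 1) q ((X - C c) * g t) =
      apolar (n + 1) q (X * g t) - c * apolar (n + 1) q (g t) := by
    intro c
    rw [sub_mul, map_sub, ← smul_eq_C_mul, map_smul, smul_eq_mul]
  have hyB : y ∉ B := by
    intro hmem
    obtain ⟨j, hj, hjy⟩ := Finset.mem_image.1 hmem
    refine h2 j hj ?_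
    change b j t = y at hjy
    rw [hjy, hlin, hy, div_mul_cancel₀ _ h1, sub_self]
  have hcard : (insert y B).card = n + 1 := by rw [Finset.card_insert_of_notMem hyB, hBcard]
  refine ⟨insert y B, fun s => apolar (n + 1) q (Lagrange.basis (insert y B) id s), 0, ?_,
    hcard.le, Or.inl rfl⟩
  rw [C_0, add_zero]
  refine eq_sum_pow_of_apolar hq _ fun j hj => ?_
  obtain rfl : j = 0 := by omega
  rw [pow_zero, one_mul, Lagrange.nodal_insert_eq_nodal hyB, hgB, id, hlin, hy,
    div_mul_cancel₀ _ h1, sub_self]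

lemma exists_aeval_eq_zero_im_ne_zero_of_not_splits {p : ℝ[X]} (hp : ¬ p.Splits) :
    ∃ z : ℂ, z.im ≠ 0 ∧ aeval z p = 0 := by
  by_contra! h
  refine hp (Splits.of_splits_map (algebraMap ℝ ℂ) (IsAlgClosed.splits _) fun z hz => ?_)
  have hroot : aeval z p = 0 := by
    rw [← eval_map_algebraMap]
    exact isRoot_of_mem_roots hz
  have him : z.im = 0 := by
    by_contra him
    exact h z him hroot
  exact ⟨z.re, Complex.ext rfl (by simp [him])⟩

lemma not_splits_of_aeval_eq_zero {p : ℝ[X]} (hp : p ≠ 0) {z : ℂ} (hz : z.im ≠ 0)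
    (h : aeval z p = 0) : ¬ p.Splits := by
  intro hs
  obtain ⟨x, rfl⟩ := hs.mem_range_of_isRoot hp (i := algebraMap ℝ ℂ) (x := z)
    (by rwa [IsRoot, eval_map_algebraMap])
  exact hz (Complex.ofReal_im x)

lemma Splits.exists_eq_prod_linear {d : ℕ} {p : ℝ[X]} (hp : p.Splits) (hd : p.natDegree ≤ d + 1) :
    ∃ l : Fin (d + 1) → ℝ × ℝ, p = ∏ i, (C (l i).1 * X + C (l i).2) := by
  induction d generalizing p with
  | zero =>
    obtain ⟨a, b, rfl⟩ := exists_eq_X_add_C_of_natDegree_le_one hd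
    exact ⟨fun _ => (a, b), by simp⟩
  | succ d ih =>
    rcases Nat.lt_or_ge (d + 1) p.natDegree with hlt | hle
    · have hdeg : p.natDegree ≠ 0 := by omega
      obtain ⟨r, hr⟩ := hp.exists_eval_eq_zero (degree_ne_of_natDegree_ne hdeg)
      obtain ⟨g, rfl⟩ := dvd_iff_isRoot.2 hr
      have hg : g ≠ 0 := by
        rintro rfl
        simp at hdeg
      rw [natDegree_mul (X_sub_C_ne_zero r) hg, natDegree_X_sub_C] at hd
      obtain ⟨l, hl⟩ := ih (splits_X_sub_C_mul_iff.1 hp) (by omega)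
      refine ⟨Fin.cons (1, -r) l, ?_⟩
      rw [Fin.prod_univ_succ, Fin.cons_zero]
      simp only [Fin.cons_succ]
      rw [← hl, C_1, one_mul, C_neg, sub_eq_add_neg]
    · obtain ⟨l, hl⟩ := ih hp hle
      refine ⟨Fin.cons (0, 1) l, ?_⟩
      rw [Fin.prod_univ_succ, Fin.cons_zero]
      simp only [Fin.cons_succ]
      rw [← hl, C_0, zero_mul, zero_add, C_1, one_mul]

end Polynomial

namespace MvPolynomial

/-- The bivariate polynomial `f` is a combination of `r` powers `ℓ ^ d` of linear forms. -/
def IsFormSum (d r : ℕ) (f : MvPolynomial (Fin 2) ℝ) : Prop :=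
  ∃ lam : Fin r → ℝ, ∃ l : Fin r → ℝ × ℝ,
    f = ∑ i, C (lam i) * (C (l i).1 * X 0 + C (l i).2 * X 1) ^ d

/-- The substitution `x ↦ a x + b y`, `y ↦ c x + e y`. -/
noncomputable def linSubst (a b c e : ℝ) :
    MvPolynomial (Fin 2) ℝ →ₐ[ℝ] MvPolynomial (Fin 2) ℝ :=
  aeval ![C a * X 0 + C b * X 1, C c * X 0 + C e * X 1]

lemma linSubst_C (a b c e u : ℝ) : linSubst a b c e (C u) = C u := by
  simp [linSubst, algebraMap_eq]

lemma linSubst_linear (a b c e u v : ℝ) : linSubst a b c e (C u * X 0 + C v * X 1) =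
    C (u * a + v * c) * X 0 + C (u * b + v * e) * X 1 := by
  simp only [linSubst, map_add, map_mul, aeval_X, aeval_C, algebraMap_eq, Matrix.cons_val_zero,
    Matrix.cons_val_one]
  ring

lemma linSubst_X_zero (a b c e : ℝ) : linSubst a b c e (X 0) = C a * X 0 + C b * X 1 := by
  simp [linSubst]

lemma linSubst_X_one (a b c e : ℝ) : linSubst a b c e (X 1) = C c * X 0 + C e * X 1 := by
  simp [linSubst]

lemma linSubst_leftInverse {a b c e : ℝ} (h : a * e - b * c ≠ 0) (f : MvPolynomial (Fin 2) ℝ) :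
    linSubst (e / (a * e - b * c)) (-b / (a * e - b * c)) (-c / (a * e - b * c))
      (a / (a * e - b * c)) (linSubst a b c e f) = f := by
  generalize hΔ : a * e - b * c = Δ at h ⊢
  induction f using MvPolynomial.induction_on with
  | C u => rw [linSubst_C, linSubst_C]
  | add f g hf hg => rw [map_add, map_add, hf, hg]
  | mul_X f i hf =>
    rw [map_mul, map_mul, hf]
    congr 1
    match i with
    | 0 =>
      rw [linSubst_X_zero, linSubst_linear,
        show a * (e / Δ) + b * (-c / Δ) = 1 by field_simp; linear_combination hΔ,
        show a * (-b / Δ) + b * (a / Δ) = 0 by ring]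
      simp
    | 1 =>
      rw [linSubst_X_one, linSubst_linear,
        show c * (e / Δ) + e * (-c / Δ) = 0 by ring,
        show c * (-b / Δ) + e * (a / Δ) = 1 by field_simp; linear_combination hΔ]
      simp

lemma isHomogeneous_linear (a b : ℝ) :
    (C a * X 0 + C b * X 1 : MvPolynomial (Fin 2) ℝ).IsHomogeneous 1 :=
  (isHomogeneous_C_mul_X a 0).add (isHomogeneous_C_mul_X b 1)

lemma IsHomogeneous.map_linSubst {d : ℕ} {f : MvPolynomial (Fin 2) ℝ} (hf : f.IsHomogeneous d)
    (a b c e : ℝ) : (linSubst a b c e f).IsHomogeneous d := by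
  have := hf.aeval ![C a * X 0 + C b * X 1, C c * X 0 + C e * X 1] (n := 1)
    (Fin.forall_fin_two.2 ⟨isHomogeneous_linear a b, isHomogeneous_linear c e⟩)
  rwa [one_mul] at this

lemma _root_.Hyperbolic.map_linSubst {d : ℕ} {f : MvPolynomial (Fin 2) ℝ} (hf : Hyperbolic d f)
    (a b c e : ℝ) : Hyperbolic d (linSubst a b c e f) := by
  obtain ⟨l, rfl⟩ := hf
  refine ⟨fun i => ((l i).1 * a + (l i).2 * c, (l i).1 * b + (l i).2 * e), ?_⟩
  simp only [map_prod, linSubst_linear]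

lemma IsFormSum.map_linSubst {d r : ℕ} {f : MvPolynomial (Fin 2) ℝ} (hf : IsFormSum d r f)
    (a b c e : ℝ) : IsFormSum d r (linSubst a b c e f) := by
  obtain ⟨lam, l, rfl⟩ := hf
  refine ⟨lam, fun i => ((l i).1 * a + (l i).2 * c, (l i).1 * b + (l i).2 * e), ?_⟩
  simp only [map_sum, map_mul, map_pow, linSubst_C, linSubst_linear]

lemma pderiv_zero_linSubst (a b c e : ℝ) (f : MvPolynomial (Fin 2) ℝ) :
    pderiv 0 (linSubst a b c e f) =
      linSubst a b c e (C a * pderiv 0 f + C c * pderiv 1 f) := by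
  induction f using MvPolynomial.induction_on with
  | C u => simp
  | add f g hf hg =>
    simp only [map_add, hf, hg, mul_add]
    ring
  | mul_X f i hf =>
    match i with
    | 0 =>
      simp only [map_mul, map_add, pderiv_mul, pderiv_X_self, pderiv_X_of_ne zero_ne_one,
        pderiv_X_of_ne one_ne_zero, pderiv_C, linSubst_X_zero, linSubst_C, hf, map_zero, map_one]
      ring
    | 1 =>
      simp only [map_mul, map_add, pderiv_mul, pderiv_X_self, pderiv_X_of_ne one_ne_zero,
        pderiv_C, linSubst_X_one, linSubst_C, hf, map_zero, map_one]
      ring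

/-- Dehomogenization `x ↦ X`, `y ↦ 1` of a bivariate polynomial. -/
noncomputable def dehomogenize : MvPolynomial (Fin 2) ℝ →ₐ[ℝ] Polynomial ℝ :=
  aeval ![Polynomial.X, 1]

lemma dehomogenize_C (u : ℝ) : dehomogenize (C u) = Polynomial.C u := by
  simp [dehomogenize, Polynomial.algebraMap_eq]

lemma dehomogenize_X_zero : dehomogenize (X 0) = Polynomial.X := by
  simp [dehomogenize]

lemma dehomogenize_X_one : dehomogenize (X 1) = 1 := by
  simp [dehomogenize]

lemma dehomogenize_linear (a b : ℝ) : dehomogenize (C a * X 0 + C b * X 1) =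
    Polynomial.C a * Polynomial.X + Polynomial.C b := by
  simp only [map_add, map_mul, dehomogenize_C, dehomogenize_X_zero, dehomogenize_X_one, mul_one]

lemma natDegree_dehomogenize_le {d : ℕ} {f : MvPolynomial (Fin 2) ℝ} (hf : f.IsHomogeneous d) :
    (dehomogenize f).natDegree ≤ d := by
  rw [f.as_sum, map_sum]
  refine Polynomial.natDegree_sum_le_of_forall_le _ _ fun m hm => ?_
  have hdeg : m 0 + m 1 = d := by
    have := hf (mem_support_iff.1 hm)
    simpa [Finsupp.weight_apply, Finsupp.sum_fintype] using this
  rw [dehomogenize, aeval_monomial, Polynomial.algebraMap_eq, Finsupp.prod_fintype _ _ (by simp)]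
  simp only [Fin.prod_univ_two, Matrix.cons_val_zero, Matrix.cons_val_one, one_pow, mul_one]
  exact (Polynomial.natDegree_C_mul_X_pow_le _ _).trans (by omega)

lemma IsHomogeneous.dehomogenize_injective {d : ℕ} {f g : MvPolynomial (Fin 2) ℝ}
    (hf : f.IsHomogeneous d) (hg : g.IsHomogeneous d) (h : dehomogenize f = dehomogenize g) :
    f = g := by
  rw [← Polynomial.homogenize_eq_of_isHomogeneous hf rfl,
    ← Polynomial.homogenize_eq_of_isHomogeneous hg rfl]
  exact congrArg (Polynomial.homogenize · d) h

lemma dehomogenize_pderiv_zero (f : MvPolynomial (Fin 2) ℝ) :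
    dehomogenize (pderiv 0 f) = Polynomial.derivative (dehomogenize f) := by
  induction f using MvPolynomial.induction_on with
  | C u => simp
  | add f g hf hg => simp [hf, hg]
  | mul_X f i hf =>
    fin_cases i
    · simp [hf, pderiv_X, dehomogenize_X_zero]
      ring
    · simp [hf, pderiv_X, dehomogenize_X_one]

lemma IsHomogeneous.dehomogenize_pderiv_one {d : ℕ} {f : MvPolynomial (Fin 2) ℝ}
    (hf : f.IsHomogeneous d) : dehomogenize (pderiv 1 f) =
      (d : Polynomial ℝ) * dehomogenize f -
        Polynomial.X * Polynomial.derivative (dehomogenize f) := by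
  have := congrArg dehomogenize hf.sum_X_mul_pderiv
  rw [Fin.sum_univ_two, map_add, map_mul, map_mul, map_nsmul, dehomogenize_X_zero,
    dehomogenize_X_one, dehomogenize_pderiv_zero, nsmul_eq_mul] at this
  linear_combination this

lemma isHomogeneous_linear_pow (d : ℕ) (lam a b : ℝ) :
    (C lam * (C a * X 0 + C b * X 1) ^ d : MvPolynomial (Fin 2) ℝ).IsHomogeneous d := by
  simpa using ((isHomogeneous_linear a b).pow d).C_mul lam

lemma dehomogenize_linear_pow (d : ℕ) (lam a b : ℝ) :
    dehomogenize (C lam * (C a * X 0 + C b * X 1) ^ d) =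
      Polynomial.C lam * (Polynomial.C a * Polynomial.X + Polynomial.C b) ^ d := by
  rw [map_mul, map_pow, dehomogenize_C, dehomogenize_linear]

lemma IsFormSum.isHomogeneous {d r : ℕ} {f : MvPolynomial (Fin 2) ℝ} (hf : IsFormSum d r f) :
    f.IsHomogeneous d := by
  obtain ⟨lam, l, rfl⟩ := hf
  exact .sum _ _ _ fun i _ => isHomogeneous_linear_pow d _ _ _

lemma IsFormSum.isWaringSum_dehomogenize {d r : ℕ} {f : MvPolynomial (Fin 2) ℝ}
    (hf : IsFormSum d r f) :
    Polynomial.IsWaringSum d r (dehomogenize f) := by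
  obtain ⟨lam, l, rfl⟩ := hf
  refine ⟨lam, fun i => (l i).1, fun i => (l i).2, ?_⟩
  simp only [map_sum, dehomogenize_linear_pow]

lemma IsHomogeneous.isFormSum {d r : ℕ} {f : MvPolynomial (Fin 2) ℝ} (hf : f.IsHomogeneous d)
    (h : Polynomial.IsWaringSum d r (dehomogenize f)) : IsFormSum d r f := by
  obtain ⟨lam, a, b, h⟩ := h
  refine ⟨lam, fun i => (a i, b i), hf.dehomogenize_injective
    (.sum _ _ _ fun i _ => isHomogeneous_linear_pow d _ _ _) ?_⟩
  simp only [h, map_sum, dehomogenize_linear_pow]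

lemma _root_.Hyperbolic.splits_dehomogenize {d : ℕ} {f : MvPolynomial (Fin 2) ℝ}
    (hf : Hyperbolic d f) : (MvPolynomial.dehomogenize f).Splits := by
  obtain ⟨l, rfl⟩ := hf
  rw [map_prod]
  refine Polynomial.Splits.prod fun i _ => ?_
  rw [dehomogenize_linear]
  exact .of_natDegree_le_one Polynomial.natDegree_linear_le

lemma IsHomogeneous.hyperbolic {d : ℕ} {f : MvPolynomial (Fin 2) ℝ} (hd : 1 ≤ d)
    (hf : f.IsHomogeneous d) (h : (dehomogenize f).Splits) : Hyperbolic d f := by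
  obtain ⟨n, rfl⟩ := Nat.exists_eq_add_of_le' hd
  obtain ⟨l, hl⟩ := h.exists_eq_prod_linear (natDegree_dehomogenize_le hf)
  refine ⟨l, hf.dehomogenize_injective ?_ ?_⟩
  · simpa using IsHomogeneous.prod Finset.univ (fun i => C (l i).1 * X 0 + C (l i).2 * X 1)
      (fun _ => 1) fun i _ => isHomogeneous_linear _ _
  · simp only [hl, map_prod, dehomogenize_linear]

/-- A form of degree `d ≥ 3` that is not hyperbolic is a combination of `d - 1` powers of linear
forms. -/
lemma IsHomogeneous.isFormSum_of_not_hyperbolic {n : ℕ} (hn : 2 ≤ n)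
    {f : MvPolynomial (Fin 2) ℝ} (hf : f.IsHomogeneous (n + 1)) (h : ¬ Hyperbolic (n + 1) f) :
    IsFormSum (n + 1) n f := by
  induction n, hn using Nat.le_induction generalizing f with
  | base =>
    obtain ⟨z, hz, hz0⟩ := Polynomial.exists_aeval_eq_zero_im_ne_zero_of_not_splits
      fun hs => h (hf.hyperbolic (by omega) hs)
    exact hf.isFormSum (Polynomial.isWaringSum_two_of_cubic (natDegree_dehomogenize_le hf) hz hz0)
  | succ n hn ih =>
    obtain ⟨z₀, hz₀, h0⟩ := Polynomial.exists_aeval_eq_zero_im_ne_zero_of_not_splits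
      fun hs => h (hf.hyperbolic (by omega) hs)
    obtain ⟨a, c, hac, z, hz, hpolar⟩ :=
      Polynomial.exists_polar_nonreal_root (d := n + 1 + 1) (by omega) hz₀ h0
    have hdet : a * a - -c * c ≠ 0 := by
      rcases hac with ha | hc
      · nlinarith [mul_self_pos.2 ha, mul_self_nonneg c]
      · nlinarith [mul_self_pos.2 hc, mul_self_nonneg a]
    set D := C a * pderiv 0 f + C c * pderiv 1 f with hD
    have hDhom : D.IsHomogeneous (n + 1) := (hf.pderiv.C_mul a).add (hf.pderiv.C_mul c)
    set g := linSubst a (-c) c a f with hg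
    have hghom : g.IsHomogeneous (n + 1 + 1) := hf.map_linSubst a (-c) c a
    have hgnot : ¬ Hyperbolic (n + 1 + 1) g := by
      intro hhyp
      rw [← linSubst_leftInverse hdet f] at h
      exact h (hhyp.map_linSubst _ _ _ _)
    have hgD : pderiv 0 g = linSubst a (-c) c a D := pderiv_zero_linSubst a (-c) c a f
    have hgsplits : ¬ (dehomogenize g).Splits := fun hs => hgnot (hghom.hyperbolic (by omega) hs)
    have hD0 : D ≠ 0 := by
      intro hzero
      have hder : Polynomial.derivative (dehomogenize g) = 0 := by
        rw [← dehomogenize_pderiv_zero, hgD, hzero, map_zero, map_zero]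
      exact hgsplits (.of_natDegree_eq_zero (Polynomial.derivative_eq_zero.1 hder))
    have hDdeh : dehomogenize D ≠ 0 := fun hzero =>
      hD0 (hDhom.dehomogenize_injective (isHomogeneous_zero _ _ _) (by rw [hzero, map_zero]))
    have hDroot : Polynomial.aeval z (dehomogenize D) = 0 := by
      rw [hD, map_add, map_mul, map_mul, dehomogenize_C, dehomogenize_C, dehomogenize_pderiv_zero,
        hf.dehomogenize_pderiv_one, ← hpolar]
      simp
    have hDnot : ¬ Hyperbolic (n + 1) (pderiv 0 g) := by
      intro hhyp
      have := hhyp.map_linSubst (a / (a * a - -c * c)) (-(-c) / (a * a - -c * c))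
        (-c / (a * a - -c * c)) (a / (a * a - -c * c))
      rw [hgD, linSubst_leftInverse hdet] at this
      exact Polynomial.not_splits_of_aeval_eq_zero hDdeh hz hDroot this.splits_dehomogenize
    have hsum := (ih (hgD ▸ hDhom.map_linSubst a (-c) c a) hDnot).isWaringSum_dehomogenize
    rw [dehomogenize_pderiv_zero] at hsum
    have hgsum := hghom.isFormSum
      (Polynomial.IsPowerSum.of_derivative (n := n + 1) (by omega) hgsplits
        hsum.isPowerSum).isWaringSum
    rw [← linSubst_leftInverse hdet f]
    exact hgsum.map_linSubst _ _ _ _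

/-- A hyperbolic form of degree `d` that is a combination of fewer than `d` powers of linear forms
is a multiple of a power of a linear form. -/
lemma IsFormSum.eq_pow_of_hyperbolic {d r : ℕ} (hr : r < d) {f : MvPolynomial (Fin 2) ℝ}
    (hf : IsFormSum d r f) (h : Hyperbolic d f) :
    ∃ lam a b : ℝ, f = C lam * (C a * X 0 + C b * X 1) ^ d := by
  induction r generalizing d f with
  | zero =>
    obtain ⟨lam, l, rfl⟩ := hf
    exact ⟨0, 0, 0, by simp⟩
  | succ r ih =>
    obtain ⟨n, rfl⟩ : ∃ n, d = n + 1 := ⟨d - 1, by omega⟩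
    have hfsum := hf
    obtain ⟨lam, l, hfl⟩ := hf
    rcases Nat.eq_zero_or_pos r with rfl | hrpos
    · exact ⟨lam 0, (l 0).1, (l 0).2, by simpa using hfl⟩
    obtain ⟨κ, u, v, huv, hκ⟩ : ∃ κ u v : ℝ, v * v - u * -u ≠ 0 ∧
        C (lam 0) * (C (l 0).1 * X 0 + C (l 0).2 * X 1) ^ (n + 1) =
          (C κ * (C u * X 0 + C v * X 1) ^ (n + 1) : MvPolynomial (Fin 2) ℝ) := by
      by_cases hl : (l 0).1 = 0 ∧ (l 0).2 = 0
      · exact ⟨0, 0, 1, by norm_num, by simp [hl.1, hl.2]⟩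
      · refine ⟨lam 0, (l 0).1, (l 0).2, ?_, rfl⟩
        rcases not_and_or.1 hl with hu | hv
        · nlinarith [mul_self_pos.2 hu, mul_self_nonneg (l 0).2]
        · nlinarith [mul_self_pos.2 hv, mul_self_nonneg (l 0).1]
    set g := linSubst v u (-u) v f with hg
    have hghom : g.IsHomogeneous (n + 1) := hfsum.isHomogeneous.map_linSubst v u (-u) v
    have hgsplits : (dehomogenize g).Splits := (h.map_linSubst v u (-u) v).splits_dehomogenize
    set f' := ∑ i : Fin r, C (lam i.succ) *
      (C (l i.succ).1 * X 0 + C (l i.succ).2 * X 1 : MvPolynomial (Fin 2) ℝ) ^ (n + 1) with hf'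
    have hf'sum : IsFormSum (n + 1) r f' := ⟨fun i => lam i.succ, fun i => l i.succ, rfl⟩
    have hgdeh : dehomogenize g = Polynomial.C (κ * (u * u + v * v) ^ (n + 1)) +
        dehomogenize (linSubst v u (-u) v f') := by
      rw [hg, hfl, Fin.sum_univ_succ, hκ, ← hf', map_add, map_add, map_mul, map_pow, linSubst_C,
        linSubst_linear, show u * v + v * -u = 0 by ring, dehomogenize_linear_pow]
      simp
    have hder : Polynomial.IsWaringSum n r (Polynomial.derivative (dehomogenize g)) := by
      rw [hgdeh, Polynomial.derivative_add, Polynomial.derivative_C, zero_add]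
      exact (hf'sum.map_linSubst v u (-u) v).isWaringSum_dehomogenize.derivative
    have hg'hom : (pderiv 0 g).IsHomogeneous n := hghom.pderiv
    obtain ⟨μ, a, b, hμ⟩ := ih (by omega)
      (hg'hom.isFormSum (by rwa [dehomogenize_pderiv_zero]))
      (hg'hom.hyperbolic (by omega) (by
        rw [dehomogenize_pderiv_zero]
        exact hgsplits.derivative_real))
    replace hμ := congrArg dehomogenize hμ
    rw [dehomogenize_pderiv_zero, dehomogenize_linear_pow] at hμ
    obtain ⟨μ', a', b', hp⟩ : ∃ μ' a' b' : ℝ, dehomogenize g = Polynomial.C μ' *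
        (Polynomial.C a' * Polynomial.X + Polynomial.C b') ^ (n + 1) := by
      by_cases ha : a = 0
      · obtain ⟨c, hc⟩ : ∃ c, dehomogenize g =
            Polynomial.C (μ * b ^ n) * Polynomial.X + Polynomial.C c := by
          refine ⟨(dehomogenize g - Polynomial.C (μ * b ^ n) * Polynomial.X).coeff 0, ?_⟩
          rw [← Polynomial.eq_C_of_derivative_eq_zero, add_sub_cancel]
          simp [hμ, ha]
        have hsum := (hfsum.map_linSubst v u (-u) v).isWaringSum_dehomogenize.isPowerSum
        rw [← hg, hc] at hsum
        rw [hsum.eq_zero_of_linear (by omega) hr] at hc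
        exact ⟨c, 0, 1, by simpa using hc⟩
      · exact hgsplits.eq_pow_of_derivative_eq_pow (by omega) ha hμ
    rw [← dehomogenize_linear_pow] at hp
    rw [← linSubst_leftInverse huv f, ← hg,
      hghom.dehomogenize_injective (isHomogeneous_linear_pow _ _ _ _) hp]
    exact ⟨μ', _, _, by rw [map_mul, map_pow, linSubst_C, linSubst_linear]⟩

end MvPolynomial

lemma waringRank_le {d r : ℕ} {f : MvPolynomial (Fin 2) ℝ} (h : MvPolynomial.IsFormSum d r f) :
    waringRank d f ≤ r :=
  sInf_le ⟨r, h, rfl⟩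

/-- A nonzero binary form of degree `d ≥ 3` which is not a scalar multiple of a `d`-th
power of a real linear form has real Waring rank `d` if and only if it is hyperbolic. -/
theorem statement9 (d : ℕ) (hd : 3 ≤ d) (f : MvPolynomial (Fin 2) ℝ)
    (hf0 : f ≠ 0) (hfhom : f.IsHomogeneous d)
    (hpow : ¬ ∃ (lam a b : ℝ), f = C lam * (C a * X 0 + C b * X 1) ^ d) :
    waringRank d f = d ↔ Hyperbolic d f := by
  constructor
  · intro hrank
    by_contra hhyp
    obtain ⟨n, rfl⟩ : ∃ n, d = n + 1 := ⟨d - 1, by omega⟩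
    have hle := waringRank_le (hfhom.isFormSum_of_not_hyperbolic (by omega) hhyp)
    rw [hrank, Nat.cast_le] at hle
    omega
  · intro hhyp
    refine le_antisymm (waringRank_le (hfhom.isFormSum ?_)) (le_sInf ?_)
    · refine (Polynomial.isPowerSum_self (natDegree_dehomogenize_le hfhom) fun hder =>
        hpow ⟨(dehomogenize f).coeff 0, 0, 1, ?_⟩).isWaringSum
      refine hfhom.dehomogenize_injective (isHomogeneous_linear_pow _ _ _ _) ?_
      rw [Polynomial.eq_C_of_derivative_eq_zero hder, dehomogenize_linear_pow]
      simp
    · rintro _ ⟨r, hr, rfl⟩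
      rw [Nat.cast_le]
      by_contra! hlt
      exact hpow (MvPolynomial.IsFormSum.eq_pow_of_hyperbolic hlt hr hhyp)
end

section
/- Let e ≥ 2 and let h be a nonzero binary form of degree e with real Waring rank at most e − 1. Assume that every representation h = λ₁ℓ₁^e + ⋯ + λ_rℓ_r^e with r ≤ e − 1, nonzero λ₁,…,λ_r ∈ ℝ, and real linear forms ℓ₁,…,ℓ_r has some ℓ_i proportional to y. Then there exist a, b ∈ ℝ and a real linear form ℓ such that h = a·y^e + b·ℓ^e. -/
open scoped BigOperators
open MvPolynomial

open Filter Topology in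
/-- Adding a polynomial `Q` of degree less than `#S` to `(X - M) ∏_{s ∈ S} (X - s)` keeps all
roots real and distinct once `M` is large. -/
theorem exists_finset_prod_X_sub_C_eq_add (S : Finset ℝ) (Q : Polynomial ℝ)
    (hQ : Q.degree < S.card) :
    ∃ (U : Finset ℝ) (M : ℝ), U.card = S.card + 1 ∧
      ∏ u ∈ U, (Polynomial.X - Polynomial.C u) =
        (Polynomial.X - Polynomial.C M) * ∏ s ∈ S, (Polynomial.X - Polynomial.C s) + Q := by
  set G : Polynomial ℝ := ∏ s ∈ S, (Polynomial.X - Polynomial.C s) with hG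
  have hGmonic : G.Monic := Polynomial.monic_prod_X_sub_C _ _
  have hGdeg : G.degree = S.card := by
    rw [hG, Polynomial.degree_prod]; simp
  have hGeval (x : ℝ) : G.eval x = ∏ s ∈ S, (x - s) := by
    simp [hG, Polynomial.eval_prod]
  obtain ⟨δ, hδ, hsep⟩ : ∃ δ : ℝ, 0 < δ ∧ ∀ s ∈ S, ∀ t ∈ S, s ≠ t → 2 * δ < |s - t| := by
    have h1 : ∀ᶠ δ : ℝ in 𝓝[>] 0, ∀ s ∈ S, ∀ t ∈ S, s ≠ t → 2 * δ < |s - t| := by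
      rw [Filter.eventually_all_finset]
      intro s _
      rw [Filter.eventually_all_finset]
      intro t _
      rw [Filter.eventually_imp_distrib_left]
      intro hst
      have hpos : 0 < |s - t| := abs_pos.mpr (sub_ne_zero.mpr hst)
      filter_upwards [Ioo_mem_nhdsGT (half_pos hpos)] with δ hδ
      linarith [hδ.2]
    obtain ⟨δ, hδ, h2⟩ := (h1.and self_mem_nhdsWithin).exists
    exact ⟨δ, h2, hδ⟩
  obtain ⟨B, hB⟩ : ∃ B : ℝ, ∀ s ∈ S, s + δ < B := by
    obtain ⟨b, hb⟩ := S.bddAbove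
    exact ⟨b + δ + 1, fun s hs => by linarith [hb hs]⟩
  have hsign : ∀ s ∈ S, G.eval (s - δ) * G.eval (s + δ) < 0 := by
    intro s hs
    rw [hGeval, hGeval, ← Finset.prod_mul_distrib, ← Finset.mul_prod_erase S _ hs]
    refine mul_neg_of_neg_of_pos (by nlinarith) (Finset.prod_pos fun t ht => ?_)
    have h1 := hsep s hs t (Finset.mem_of_mem_erase ht) (Finset.ne_of_mem_erase ht).symm
    have h2 : δ ^ 2 < (s - t) ^ 2 := by
      rw [← sq_abs (s - t)]
      gcongr
      linarith
    nlinarith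
  have hGB : 0 < G.eval B := by
    rw [hGeval]
    exact Finset.prod_pos fun s hs => by linarith [hB s hs]
  have hlim (x : ℝ) :
      Tendsto (fun M : ℝ => M⁻¹ * (((Polynomial.X - Polynomial.C M) * G + Q).eval x))
      atTop (𝓝 (-G.eval x)) := by
    have h1 : Tendsto (fun M : ℝ => M⁻¹ * (x * G.eval x + Q.eval x) - G.eval x) atTop
        (𝓝 (0 * (x * G.eval x + Q.eval x) - G.eval x)) :=
      (tendsto_inv_atTop_zero.mul_const _).sub_const _
    rw [zero_mul, zero_sub] at h1
    refine h1.congr' ?_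
    filter_upwards [eventually_gt_atTop 0] with M hM
    simp only [Polynomial.eval_add, Polynomial.eval_mul, Polynomial.eval_sub, Polynomial.eval_X,
      Polynomial.eval_C]
    field_simp
    ring
  have hev1 : ∀ᶠ M : ℝ in atTop, ∀ s ∈ S,
      ((Polynomial.X - Polynomial.C M) * G + Q).eval (s - δ) *
        ((Polynomial.X - Polynomial.C M) * G + Q).eval (s + δ) < 0 := by
    rw [Filter.eventually_all_finset]
    intro s hs
    have h1 := (hlim (s - δ)).mul (hlim (s + δ))
    rw [neg_mul_neg] at h1
    filter_upwards [h1.eventually_lt_const (hsign s hs), eventually_gt_atTop 0] with M h2 hM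
    rw [mul_mul_mul_comm] at h2
    exact (pos_iff_neg_of_mul_neg h2).mp (by positivity)
  have hev2 : ∀ᶠ M : ℝ in atTop, ((Polynomial.X - Polynomial.C M) * G + Q).eval B < 0 := by
    filter_upwards [(hlim B).eventually_lt_const (neg_neg_of_pos hGB),
      eventually_gt_atTop 0] with M h2 hM
    exact (pos_iff_neg_of_mul_neg h2).mp (by positivity)
  obtain ⟨M, hM1, hM2⟩ := (hev1.and hev2).exists
  set P := (Polynomial.X - Polynomial.C M) * G + Q with hP
  have hmulmonic : ((Polynomial.X - Polynomial.C M) * G).Monic :=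
    (Polynomial.monic_X_sub_C M).mul hGmonic
  have hmuldeg : ((Polynomial.X - Polynomial.C M) * G).degree = ((S.card + 1 : ℕ) : WithBot ℕ) := by
    rw [Polynomial.degree_mul, hGdeg, Polynomial.degree_X_sub_C, add_comm]; rfl
  have hQlt : Q.degree < ((Polynomial.X - Polynomial.C M) * G).degree := by
    rw [hmuldeg]
    exact hQ.trans (by exact_mod_cast Nat.lt_succ_self _)
  have hPmonic : P.Monic := hmulmonic.add_of_left hQlt
  have hPdeg : P.degree = ((S.card + 1 : ℕ) : WithBot ℕ) := by
    rw [hP, Polynomial.degree_add_eq_left_of_degree_lt hQlt, hmuldeg]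
  have hroot : ∀ s : ℝ, ∃ r : ℝ, s ∈ S → P.eval r = 0 ∧ s - δ ≤ r ∧ r ≤ s + δ := by
    intro s
    by_cases hs : s ∈ S
    · have h1 := hM1 s hs
      have h0 : (0 : ℝ) ∈ Set.uIcc (P.eval (s - δ)) (P.eval (s + δ)) := by
        rw [Set.mem_uIcc]
        rcases mul_neg_iff.mp h1 with h | h
        · exact Or.inr ⟨h.2.le, h.1.le⟩
        · exact Or.inl ⟨h.1.le, h.2.le⟩
      obtain ⟨r, hr, hr0⟩ := intermediate_value_uIcc (f := fun x => P.eval x)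
        P.continuous.continuousOn h0
      rw [Set.uIcc_of_le (by linarith)] at hr
      exact ⟨r, fun _ => ⟨hr0, hr⟩⟩
    · exact ⟨0, fun h => absurd h hs⟩
  choose r hr using hroot
  obtain ⟨w, hwB, hw⟩ : ∃ w, B ≤ w ∧ P.eval w = 0 := by
    have ht : Tendsto (fun x => P.eval x) atTop atTop :=
      P.tendsto_atTop_of_leadingCoeff_nonneg
        (by rw [hPdeg]; exact_mod_cast Nat.succ_pos _)
        (by rw [hPmonic.leadingCoeff]; exact zero_le_one)
    obtain ⟨v, hv, hBv⟩ := ((ht.eventually_ge_atTop 0).and (eventually_ge_atTop B)).exists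
    obtain ⟨w, hw, hw0⟩ := intermediate_value_Icc (f := fun x => P.eval x) hBv
      P.continuous.continuousOn ⟨hM2.le, hv⟩
    exact ⟨w, hw.1, hw0⟩
  have hinj : Set.InjOn r S := by
    intro s hs t ht hst
    by_contra hne
    have h1 := hsep s hs t ht hne
    have h2 := hr s hs
    have h3 := hr t ht
    rw [hst] at h2
    have : |s - t| ≤ 2 * δ := 
      abs_le.mpr ⟨by linarith [h2.2.1, h3.2.2], by linarith [h2.2.2, h3.2.1]⟩
    linarith
  have hwnot : w ∉ S.image r := by
    intro hmem
    obtain ⟨s, hs, rfl⟩ := Finset.mem_image.mp hmem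
    linarith [(hr s hs).2.2, hB s hs]
  have hcard : (insert w (S.image r)).card = S.card + 1 := by
    rw [Finset.card_insert_of_notMem hwnot, Finset.card_image_of_injOn hinj]
  refine ⟨insert w (S.image r), M, hcard, ?_⟩
  have hprodmonic := Polynomial.monic_prod_X_sub_C (fun u : ℝ => u) (insert w (S.image r))
  have hproddeg : (∏ u ∈ insert w (S.image r), (Polynomial.X - Polynomial.C u)).degree =
      ((S.card + 1 : ℕ) : WithBot ℕ) := by
    rw [Polynomial.degree_prod, ← hcard]; simp
  refine Polynomial.eq_of_degree_sub_lt_of_eval_finset_eq (insert w (S.image r)) ?_ ?_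
  · rw [hcard, ← hproddeg]
    exact Polynomial.degree_sub_lt_left (hproddeg.trans hPdeg.symm) hprodmonic.ne_zero
      (hprodmonic.leadingCoeff.trans hPmonic.leadingCoeff.symm)
  · intro u hu
    have h1 : P.eval u = 0 := by
      rcases Finset.mem_insert.mp hu with rfl | hu
      · exact hw
      · obtain ⟨s, hs, rfl⟩ := Finset.mem_image.mp hu
        exact (hr s hs).1
    rw [h1, Polynomial.eval_prod]
    exact Finset.prod_eq_zero hu (by simp)

/-- A functional `q ↦ a · [X^(n+1)] q + ∑ c_s q(s)` on polynomials of degree at most `n + 1`,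
where `n = #S + 1` and at least two of the weights `c_s` are nonzero, is a combination of `n`
evaluations. -/
theorem exists_finset_moments_eq (S : Finset ℝ) (c : ℝ → ℝ) (a : ℝ) {s t : ℝ}
    (hs : s ∈ S) (ht : t ∈ S) (hst : s ≠ t) (hcs : c s ≠ 0) (hct : c t ≠ 0) :
    ∃ (U : Finset ℝ) (μ : ℝ → ℝ), U.card = S.card + 1 ∧ ∀ j ≤ S.card + 2,
      (if j = S.card + 2 then a else 0) + ∑ v ∈ S, c v * v ^ j = ∑ u ∈ U, μ u * u ^ j := by
  have hst' : s - t ≠ 0 := sub_ne_zero.mpr hst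
  set f : ℝ → ℝ := fun v => if v = s then -a / (c s * (s - t)) else
    if v = t then a / (c t * (s - t)) else 0 with hf
  have hsum (g : ℝ → ℝ) : ∑ v ∈ S, g v * f v = g s * f s + g t * f t := by
    refine Finset.sum_eq_add_of_mem s t hs ht hst ?_
    rintro v - ⟨h1, h2⟩
    simp [hf, h1, h2]
  have hfs : f s = -a / (c s * (s - t)) := by simp [hf]
  have hft : f t = a / (c t * (s - t)) := by simp [hf, hst.symm]
  set Q := Lagrange.interpolate S id f with hQ
  have hQdeg : Q.degree < S.card := Lagrange.degree_interpolate_lt _ (Set.injOn_id _)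
  have hQeval : ∀ v ∈ S, Q.eval v = f v := fun v hv =>
    Lagrange.eval_interpolate_at_node (v := id) f (Set.injOn_id _) hv
  obtain ⟨U, M, hU, hP⟩ := exists_finset_prod_X_sub_C_eq_add S Q hQdeg
  set P : Polynomial ℝ := ∏ u ∈ U, (Polynomial.X - Polynomial.C u) with hPdef
  have hPmonic : P.Monic := Polynomial.monic_prod_X_sub_C _ _
  have hPdeg : P.natDegree = S.card + 1 := by
    rw [hPdef, Polynomial.natDegree_prod_of_monic _ _ fun u _ => Polynomial.monic_X_sub_C u]
    simp [hU]
  have hPeval : ∀ v ∈ S, P.eval v = f v := by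
    intro v hv
    have : ∏ u ∈ S, (v - u) = 0 := Finset.prod_eq_zero hv (sub_self v)
    simp [hP, Polynomial.eval_prod, this, hQeval v hv]
  let L : Polynomial ℝ →ₗ[ℝ] ℝ :=
    a • Polynomial.lcoeff ℝ (S.card + 2) + ∑ v ∈ S, c v • Polynomial.leval v
  have hL (q : Polynomial ℝ) : L q = a * q.coeff (S.card + 2) + ∑ v ∈ S, c v * q.eval v := by
    simp [L, LinearMap.sum_apply]
  have hLP : L P = 0 := by
    rw [hL, Polynomial.coeff_eq_zero_of_natDegree_lt (by omega),
      Finset.sum_congr rfl fun v hv => by rw [hPeval v hv], hsum, hfs, hft]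
    field_simp
    ring
  have hLXP : L (Polynomial.X * P) = 0 := by
    have h1 : P.coeff (S.card + 1) = 1 := by rw [← hPdeg]; exact hPmonic.coeff_natDegree
    have h2 : ∑ v ∈ S, c v * (Polynomial.X * P).eval v = ∑ v ∈ S, (c v * v) * f v :=
      Finset.sum_congr rfl fun v hv => by
        rw [Polynomial.eval_mul, Polynomial.eval_X, hPeval v hv, mul_assoc]
    rw [hL, Polynomial.coeff_X_mul, h1, h2, hsum fun v => c v * v, hfs, hft]
    field_simp
    ring
  refine ⟨U, fun u => L (Lagrange.basis U id u), hU, fun j hj => ?_⟩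
  have hleft : (if j = S.card + 2 then a else 0) + ∑ v ∈ S, c v * v ^ j =
      L (Polynomial.X ^ j) := by
    rw [hL, Polynomial.coeff_X_pow]
    simp [eq_comm]
  have hdiv : (Polynomial.X ^ j /ₘ P).natDegree ≤ 1 := by
    rw [Polynomial.natDegree_divByMonic _ hPmonic, Polynomial.natDegree_X_pow, hPdeg]
    omega
  have hmod : (Polynomial.X ^ j %ₘ P).degree < U.card := by
    have := Polynomial.degree_modByMonic_lt (Polynomial.X ^ j) hPmonic
    rwa [Polynomial.degree_eq_natDegree hPmonic.ne_zero, hPdeg, ← hU] at this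
  have hmodeval : ∀ u ∈ U, (Polynomial.X ^ j %ₘ P).eval u = u ^ j := by
    intro u hu
    have h1 : P.eval u = 0 := by
      rw [hPdef, Polynomial.eval_prod]
      exact Finset.prod_eq_zero hu (by simp)
    have := congrArg (Polynomial.eval u) (Polynomial.modByMonic_add_div (Polynomial.X ^ j) P)
    simpa [h1] using this
  have hinterp : Polynomial.X ^ j %ₘ P = ∑ u ∈ U, u ^ j • Lagrange.basis U id u := by
    rw [Lagrange.eq_interpolate_of_eval_eq (v := id) (fun u => u ^ j) (Set.injOn_id _) hmod
        hmodeval,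
      Lagrange.interpolate_apply]
    simp [Polynomial.smul_eq_C_mul]
  rw [hleft, ← Polynomial.modByMonic_add_div (Polynomial.X ^ j) P,
    Polynomial.eq_X_add_C_of_natDegree_le_one hdiv, map_add, hinterp, map_sum]
  have hzero : ∀ α β : ℝ, L (P * (Polynomial.C α * Polynomial.X + Polynomial.C β)) = 0 := by
    intro α β
    have : P * (Polynomial.C α * Polynomial.X + Polynomial.C β) =
        α • (Polynomial.X * P) + β • P := by
      rw [Polynomial.smul_eq_C_mul, Polynomial.smul_eq_C_mul]; ring
    rw [this, map_add, map_smul, map_smul, hLP, hLXP]; simp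
  rw [hzero, add_zero]
  exact Finset.sum_congr rfl fun u _ => by rw [map_smul, smul_eq_mul, mul_comm]

/-- The sum `∑ c_s (x + s y)^e` expands with the moments of `c` as coefficients. -/
theorem sum_C_mul_X_add_C_mul_X_pow (e : ℕ) (S : Finset ℝ) (c : ℝ → ℝ) :
    ∑ s ∈ S, C (c s) * (X 0 + C s * X 1) ^ e =
      ∑ j ∈ Finset.range (e + 1),
        C (∑ s ∈ S, c s * s ^ j) *
          (X 1 ^ j * X 0 ^ (e - j) * (e.choose j : MvPolynomial (Fin 2) ℝ)) := by
  simp only [map_sum, Finset.sum_mul]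
  rw [Finset.sum_comm]
  refine Finset.sum_congr rfl fun s _ => ?_
  rw [add_comm, add_pow, Finset.mul_sum]
  refine Finset.sum_congr rfl fun j _ => ?_
  rw [mul_pow, map_mul, map_pow]
  ring

/-- If `c` is nonzero at two points of `S`, then `a y^(#S+2) + ∑_{s ∈ S} c_s (x + s y)^(#S+2)` is a
combination of `#S + 1` powers of linear forms not proportional to `y`. -/
theorem exists_finset_add_sum_eq_sum (S : Finset ℝ) (c : ℝ → ℝ) (a : ℝ) {s t : ℝ}
    (hs : s ∈ S) (ht : t ∈ S) (hst : s ≠ t) (hcs : c s ≠ 0) (hct : c t ≠ 0) :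
    ∃ (U : Finset ℝ) (μ : ℝ → ℝ), U.card = S.card + 1 ∧
      (C a * X 1 ^ (S.card + 2) + ∑ v ∈ S, C (c v) * (X 0 + C v * X 1) ^ (S.card + 2) :
        MvPolynomial (Fin 2) ℝ) = ∑ u ∈ U, C (μ u) * (X 0 + C u * X 1) ^ (S.card + 2) := by
  obtain ⟨U, μ, hU, hμ⟩ := exists_finset_moments_eq S c a hs ht hst hcs hct
  refine ⟨U, μ, hU, ?_⟩
  rw [sum_C_mul_X_add_C_mul_X_pow, sum_C_mul_X_add_C_mul_X_pow]
  have h1 : (C a * X 1 ^ (S.card + 2) : MvPolynomial (Fin 2) ℝ) =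
      ∑ j ∈ Finset.range (S.card + 2 + 1), C (if j = S.card + 2 then a else 0) *
        (X 1 ^ j * X 0 ^ (S.card + 2 - j) *
          ((S.card + 2).choose j : MvPolynomial (Fin 2) ℝ)) := by
    rw [Finset.sum_eq_single_of_mem (S.card + 2) (by simp)]
    · simp
    · intro j _ hj
      simp [hj]
  rw [h1, ← Finset.sum_add_distrib]
  refine Finset.sum_congr rfl fun j hj => ?_
  rw [← add_mul, ← C_add, hμ j (Nat.lt_succ_iff.mp (Finset.mem_range.mp hj))]

/-- The hypothesis on decompositions indexed by `Fin r` passes to decompositions indexed by a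
finset, with possibly zero coefficients. -/
theorem exists_mem_fst_eq_zero {ι : Type*} (e : ℕ) (h : MvPolynomial (Fin 2) ℝ)
    (huse : ∀ r : ℕ, r ≤ e - 1 → ∀ lam : Fin r → ℝ, ∀ l : Fin r → ℝ × ℝ,
      (∀ i, lam i ≠ 0) →
      h = ∑ i, C (lam i) * (C (l i).1 * X 0 + C (l i).2 * X 1) ^ e →
      ∃ i, (l i).1 = 0)
    (I : Finset ι) (hI : I.card ≤ e - 1) (lam : ι → ℝ) (l : ι → ℝ × ℝ)
    (hh : h = ∑ i ∈ I, C (lam i) * (C (l i).1 * X 0 + C (l i).2 * X 1) ^ e) :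
    ∃ i ∈ I, (l i).1 = 0 := by
  classical
  set J := I.filter fun i => lam i ≠ 0 with hJ
  have hsum : h = ∑ i ∈ J, C (lam i) * (C (l i).1 * X 0 + C (l i).2 * X 1) ^ e := by
    rw [hh, hJ, Finset.sum_filter_of_ne]
    intro i _ hne h0
    simp [h0] at hne
  obtain ⟨i, hi⟩ := huse J.card ((Finset.card_filter_le _ _).trans hI)
    (fun i => lam (J.equivFin.symm i)) (fun i => l (J.equivFin.symm i))
    (fun i => (Finset.mem_filter.mp (J.equivFin.symm i).2).2) (by
      rw [hsum, ← Finset.sum_coe_sort J]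
      exact (Equiv.sum_comp J.equivFin.symm fun i : J =>
        C (lam i) * (C (l i).1 * X 0 + C (l i).2 * X 1) ^ e).symm)
  exact ⟨_, (Finset.mem_filter.mp (J.equivFin.symm i).2).1, hi⟩

/-- A combination of powers of linear forms, one of which is proportional to `y`, can be
normalised to `a y^e + ∑ c_t (x + t y)^e` with fewer terms in the sum. -/
theorem exists_normalised_sum {ι : Type*} (e : ℕ) (I : Finset ι) (lam : ι → ℝ) (l : ι → ℝ × ℝ)
    (hl : ∃ i ∈ I, (l i).1 = 0) :
    ∃ (a : ℝ) (T : Finset ℝ) (c : ℝ → ℝ), T.card < I.card ∧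
      (∑ i ∈ I, C (lam i) * (C (l i).1 * X 0 + C (l i).2 * X 1) ^ e :
        MvPolynomial (Fin 2) ℝ) =
      C a * X 1 ^ e + ∑ t ∈ T, C (c t) * (X 0 + C t * X 1) ^ e := by
  classical
  set J := I.filter fun i => ¬ (l i).1 = 0 with hJ
  have hJI : J.card < I.card := by
    obtain ⟨i, hi, hi0⟩ := hl
    exact Finset.card_lt_card (Finset.filter_ssubset.mpr ⟨i, hi, by simpa using hi0⟩)
  refine ⟨∑ i ∈ I with (l i).1 = 0, lam i * (l i).2 ^ e, J.image fun i => (l i).2 / (l i).1,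
    fun t => ∑ i ∈ J with (l i).2 / (l i).1 = t, lam i * (l i).1 ^ e,
    Finset.card_image_le.trans_lt hJI, ?_⟩
  rw [← Finset.sum_filter_add_sum_filter_not I fun i => (l i).1 = 0]
  congr 1
  · rw [map_sum, Finset.sum_mul]
    refine Finset.sum_congr rfl fun i hi => ?_
    rw [(Finset.mem_filter.mp hi).2]
    simp only [map_zero, zero_mul, zero_add, mul_pow, map_mul, map_pow, mul_assoc]
  · rw [← hJ, ← Finset.sum_fiberwise_of_maps_to (s := J)
      (g := fun i => (l i).2 / (l i).1) fun i hi => Finset.mem_image_of_mem _ hi]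
    refine Finset.sum_congr rfl fun t _ => ?_
    rw [map_sum, Finset.sum_mul]
    refine Finset.sum_congr rfl fun i hi => ?_
    obtain ⟨hiJ, rfl⟩ := Finset.mem_filter.mp hi
    have hne : (l i).1 ≠ 0 := (Finset.mem_filter.mp hiJ).2
    have h1 : (C (l i).2 : MvPolynomial (Fin 2) ℝ) = C (l i).1 * C ((l i).2 / (l i).1) := by
      rw [← C_mul, mul_div_cancel₀ _ hne]
    rw [h1, C_mul, C_pow, mul_assoc (C (lam i)), ← mul_pow]
    ring

/-- If a nonzero binary form `h` of degree `e ≥ 2` has real Waring rank at most `e - 1` and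
every decomposition of `h` into at most `e - 1` powers of real linear forms (with nonzero
coefficients) uses a power of a linear form proportional to `y`, then `h = a yᵉ + b ℓᵉ`
for some reals `a, b` and some real linear form `ℓ`. -/
theorem statement11 (e : ℕ) (he : 2 ≤ e) (h : MvPolynomial (Fin 2) ℝ)
    (h0 : h ≠ 0) (hhom : h.IsHomogeneous e)
    (hrank : waringRank e h ≤ (e - 1 : ℕ))
    (huse : ∀ r : ℕ, r ≤ e - 1 → ∀ lam : Fin r → ℝ, ∀ l : Fin r → ℝ × ℝ,
      (∀ i, lam i ≠ 0) →
      h = ∑ i, C (lam i) * (C (l i).1 * X 0 + C (l i).2 * X 1) ^ e →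
      ∃ i, (l i).1 = 0) :
    ∃ a b : ℝ, ∃ l : ℝ × ℝ,
      h = C a * X 1 ^ e + C b * (C l.1 * X 0 + C l.2 * X 1) ^ e := by
  classical
  obtain ⟨r, hr, lam, l, hl⟩ : ∃ r ≤ e - 1, ∃ lam : Fin r → ℝ, ∃ l : Fin r → ℝ × ℝ,
      h = ∑ i, C (lam i) * (C (l i).1 * X 0 + C (l i).2 * X 1) ^ e := by
    obtain ⟨_, ⟨r, hmem, rfl⟩, hlt⟩ := sInf_lt_iff.mp
      (hrank.trans_lt (ENat.natCast_lt_natCast.mpr (Nat.lt_succ_self (e - 1))))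
    exact ⟨r, Nat.lt_succ_iff.mp (ENat.natCast_lt_natCast.mp hlt), hmem⟩
  obtain ⟨a, T, c, hT, hsum⟩ := exists_normalised_sum e Finset.univ lam l
    (exists_mem_fst_eq_zero e h huse Finset.univ (by simpa using hr) lam l hl)
  rw [← hl] at hsum
  rw [Finset.card_fin] at hT
  set T' := T.filter fun t => c t ≠ 0 with hT'
  have hsum' : h = C a * X 1 ^ e + ∑ t ∈ T', C (c t) * (X 0 + C t * X 1) ^ e := by
    rw [hsum, hT', Finset.sum_filter_of_ne]
    intro t _ hne hc
    simp [hc] at hne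
  rcases Nat.lt_or_ge 1 T'.card with hcard | hcard
  · exfalso
    obtain ⟨s, hs, t, ht, hst⟩ := Finset.one_lt_card.mp hcard
    have hT'T : T'.card ≤ T.card := Finset.card_filter_le _ _
    obtain ⟨S, hTS, hS⟩ := Infinite.exists_superset_card_eq T' (e - 2) (by omega)
    obtain rfl : e = S.card + 2 := by omega
    obtain ⟨U, μ, hU, hUsum⟩ := exists_finset_add_sum_eq_sum S
      (fun v => if v ∈ T' then c v else 0) a (hTS hs) (hTS ht) hst
      (by simpa [hs] using (Finset.mem_filter.mp hs).2)
      (by simpa [ht] using (Finset.mem_filter.mp ht).2)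
    rw [← Finset.sum_subset hTS fun v _ hv => by simp [hv],
      Finset.sum_congr rfl fun v hv => by rw [if_pos hv], ← hsum'] at hUsum
    obtain ⟨u, -, hu⟩ := exists_mem_fst_eq_zero _ h huse U (by omega) μ (fun u => (1, u))
      (by simpa using hUsum)
    exact one_ne_zero hu
  · rcases Finset.card_le_one_iff_subset_singleton.mp hcard with ⟨t, ht⟩
    rcases Finset.subset_singleton_iff.mp ht with h1 | h1
    · exact ⟨a, 0, 0, by simpa [h1] using hsum'⟩
    · exact ⟨a, c t, (1, t), by simpa [h1] using hsum'⟩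
end
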